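/- arXiv:0707.3607 — 4 statements merged into one kernel-verified Lean document; each statement's English description precedes it below -/
import Mathlib

section
/- Let Γ be a generalized layered graph. For every directed path π in Γ and every j with 1 ≤ j ≤ l(π), the image of e(π,j) in A(Γ) lies in the filtration subspace A(Γ)_{f(|π|,j)}, where |π| = |t(π)| and f(a,j) = ja − j(j−1)/2. -/
open scoped BigOperators

namespace GLG

variable {V E : Type}

def len (tl hd : E → V) (rk : V → ℕ) (e : E) : ℕ := rk (tl e) - rk (hd e)
def IsRank (tl hd : E → V) (rk : V → ℕ) : Prop := ∀ e : E, rk (hd e) < rk (tl e)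
def IsPathC (tl hd : E → V) (e : E) (es : List E) : Prop :=
  List.Chain (fun a b => hd a = tl b) e es
def pathDst (hd : E → V) (e : E) (es : List E) : V :=
  hd ((e :: es).getLast (List.cons_ne_nil e es))
def Reaches (tl hd : E → V) (v w : V) : Prop :=
  ∃ (e : E) (es : List E), IsPathC tl hd e es ∧ tl e = v ∧ pathDst hd e es = w

/-- The set `E^♯` of generators `a_i(e)`, `1 ≤ i ≤ l(e)`. -/
abbrev ESharp (tl hd : E → V) (rk : V → ℕ) : Type :=
  Σ e : E, {i : ℕ // 1 ≤ i ∧ i ≤ len tl hd rk e}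

/-- `P_e(t) = 1 + Σ_{j=1}^{l(e)} (-1)^j a_j(e) t^j`. -/
noncomputable def Pe (F : Type) [Field F] (tl hd : E → V) (rk : V → ℕ) (e : E) :
    Polynomial (FreeAlgebra F (ESharp tl hd rk)) :=
  1 + ∑ j ∈ (Finset.Icc 1 (len tl hd rk e)).attach,
      Polynomial.C ((-1 : FreeAlgebra F (ESharp tl hd rk)) ^ (j : ℕ) *
        FreeAlgebra.ι F (⟨e, ⟨(j : ℕ), (Finset.mem_Icc.mp j.2).1, (Finset.mem_Icc.mp j.2).2⟩⟩ :
          ESharp tl hd rk)) *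
      Polynomial.X ^ (j : ℕ)

/-- `e(π, j)`, the coefficient of `(-t)^j` in `P_π(t) = P_{e₁}(t) ⋯ P_{e_r}(t)`,
for `π` the path given by the list of edges `es`. -/
noncomputable def eP (F : Type) [Field F] (tl hd : E → V) (rk : V → ℕ)
    (es : List E) (j : ℕ) : FreeAlgebra F (ESharp tl hd rk) :=
  (-1 : FreeAlgebra F (ESharp tl hd rk)) ^ j * ((es.map (Pe F tl hd rk)).prod).coeff j

/-- The defining relations of `A(Γ)`: `e(π₁,j) = e(π₂,j)` for paths `π₁, π₂` with the same
tail and the same head, and `1 ≤ j ≤ l(π₁)`. -/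
def rel (F : Type) [Field F] (tl hd : E → V) (rk : V → ℕ) :
    FreeAlgebra F (ESharp tl hd rk) → FreeAlgebra F (ESharp tl hd rk) → Prop :=
  fun x y => ∃ (e1 : E) (es1 : List E) (e2 : E) (es2 : List E) (j : ℕ),
    IsPathC tl hd e1 es1 ∧ IsPathC tl hd e2 es2 ∧
    tl e1 = tl e2 ∧ pathDst hd e1 es1 = pathDst hd e2 es2 ∧
    1 ≤ j ∧ j ≤ rk (tl e1) - rk (pathDst hd e1 es1) ∧
    x = eP F tl hd rk (e1 :: es1) j ∧ y = eP F tl hd rk (e2 :: es2) j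

/-- The algebra `A(Γ) = T(E^♯)/R`. -/
noncomputable abbrev AGamma (F : Type) [Field F] (tl hd : E → V) (rk : V → ℕ) : Type :=
  RingQuot (rel F tl hd rk)

/-- The canonical projection `T(E^♯) → A(Γ)`. -/
noncomputable def mkA (F : Type) [Field F] (tl hd : E → V) (rk : V → ℕ) :
    FreeAlgebra F (ESharp tl hd rk) →ₐ[F] AGamma F tl hd rk :=
  RingQuot.mkAlgHom F (rel F tl hd rk)

/-- `f(a,j) = ja - j(j-1)/2`. -/
def fN (a j : ℕ) : ℕ := j * a - j * (j - 1) / 2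

/-- The filtration weight `|a_i(e)| = f(|t(e)|, i)` of a generator. -/
def wt (tl hd : E → V) (rk : V → ℕ) (s : ESharp tl hd rk) : ℕ := fN (rk (tl s.1)) s.2.1

/-- The filtration subspace `A(Γ)_n`: the span of the images of the products of generators
of total weight at most `n`. -/
noncomputable def filt (F : Type) [Field F] (tl hd : E → V) (rk : V → ℕ) (n : ℕ) :
    Submodule F (AGamma F tl hd rk) :=
  Submodule.span F {x : AGamma F tl hd rk | ∃ w : List (ESharp tl hd rk),
    (w.map (wt tl hd rk)).sum ≤ n ∧ x = mkA F tl hd rk ((w.map (FreeAlgebra.ι F)).prod)}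

/-- The degree-`n` homogeneous component `A(Γ)_{[n]}` (for the grading with `deg a_i(e) = i`):
the image in `A(Γ)` of the span of the words of total degree `n`. -/
noncomputable def gpiece (F : Type) [Field F] (tl hd : E → V) (rk : V → ℕ) (n : ℕ) :
    Submodule F (AGamma F tl hd rk) :=
  Submodule.span F {x : AGamma F tl hd rk | ∃ w : List (ESharp tl hd rk),
    (w.map (fun s => s.2.1)).sum = n ∧ x = mkA F tl hd rk ((w.map (FreeAlgebra.ι F)).prod)}

/-- The Hilbert series `H(A(Γ), z) = Σ_n dim_F A(Γ)_{[n]} · z^n ∈ ℤ[[z]]`. -/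
noncomputable def hilb (F : Type) [Field F] (tl hd : E → V) (rk : V → ℕ) : PowerSeries ℤ :=
  PowerSeries.mk fun n => (Module.finrank F (gpiece F tl hd rk n) : ℤ)


/-- `v ≥ w` in the poset of the graph. -/
def GE (tl hd : E → V) (v w : V) : Prop := v = w ∨ Reaches tl hd v w

/-- The Möbius function of the poset of the graph: the sum of `(-1)^(l+1)` over all
chains `v = v₁ > v₂ > ⋯ > v_l = w`. -/
noncomputable def mob (tl hd : E → V) (v w : V) : ℤ :=
  ∑ᶠ c ∈ {c : List V | c.Chain' (Reaches tl hd) ∧ c.head? = some v ∧ c.getLast? = some w},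
    (-1 : ℤ) ^ (c.length + 1)

/-- `M(Γ)(z) = Σ_{v ≥ w} μ(v,w) z^{|v|-|w|}`, as a formal power series over `ℤ`. -/
noncomputable def MGamma (tl hd : E → V) (rk : V → ℕ) : PowerSeries ℤ :=
  ∑ᶠ p ∈ {p : V × V | GE tl hd p.1 p.2},
    mob tl hd p.1 p.2 • (PowerSeries.X : PowerSeries ℤ) ^ (rk p.1 - rk p.2)

/-- `M_∘(Γ)(z) = Σ_{x ∈ V} μ(x, v_min) z^{|x|-|v_min|}`. -/
noncomputable def MLow (tl hd : E → V) (rk : V → ℕ) (vmin : V) : PowerSeries ℤ :=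
  ∑ᶠ x : V, mob tl hd x vmin • (PowerSeries.X : PowerSeries ℤ) ^ (rk x - rk vmin)

noncomputable def MUp (tl hd : E → V) (rk : V → ℕ) (vmax : V) : PowerSeries ℤ :=
  ∑ᶠ x : V, mob tl hd vmax x • (PowerSeries.X : PowerSeries ℤ) ^ (rk vmax - rk x)

end GLG

namespace GLG

variable {V E : Type} (F : Type) [Field F] (tl hd : E → V) (rk : V → ℕ)

theorem filt_mul {m n : ℕ} {x y : AGamma F tl hd rk} (hx : x ∈ filt F tl hd rk m)
    (hy : y ∈ filt F tl hd rk n) : x * y ∈ filt F tl hd rk (m + n) := by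
  have h := Submodule.mul_mem_mul hx hy
  unfold filt at h
  rw [Submodule.span_mul_span] at h
  refine Submodule.span_mono ?_ h
  rintro _ ⟨_, ⟨w1, h1, rfl⟩, _, ⟨w2, h2, rfl⟩, rfl⟩
  refine ⟨w1 ++ w2, ?_, ?_⟩
  · simp only [List.map_append, List.sum_append]; omega
  · simp

theorem filt_mono {m n : ℕ} (h : m ≤ n) : filt F tl hd rk m ≤ filt F tl hd rk n := by
  apply Submodule.span_mono
  rintro _ ⟨w, h1, rfl⟩
  exact ⟨w, h1.trans h, rfl⟩

theorem one_mem_filt (n : ℕ) : (1 : AGamma F tl hd rk) ∈ filt F tl hd rk n :=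
  Submodule.subset_span ⟨[], by simp, by simp⟩

theorem neg_pow_mul_mem {n : ℕ} {x : FreeAlgebra F (ESharp tl hd rk)} (i : ℕ)
    (h : mkA F tl hd rk x ∈ filt F tl hd rk n) :
    mkA F tl hd rk ((-1) ^ i * x) ∈ filt F tl hd rk n := by
  rcases neg_one_pow_eq_or (FreeAlgebra F (ESharp tl hd rk)) i with h1 | h1 <;> rw [h1]
  · simpa using h
  · simpa using h

theorem Pe_coeff (e : E) (i : ℕ) :
    mkA F tl hd rk ((Pe F tl hd rk e).coeff i) ∈ filt F tl hd rk (fN (rk (tl e)) i) ∧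
    (len tl hd rk e < i → (Pe F tl hd rk e).coeff i = 0) := by
  unfold Pe
  simp only [Polynomial.coeff_add, Polynomial.finsetSum_coeff, Polynomial.coeff_C_mul_X_pow]
  constructor
  · rw [map_add, map_sum]
    refine Submodule.add_mem _ ?_ (Submodule.sum_mem _ ?_)
    · rw [Polynomial.coeff_one]
      split_ifs
      · simpa using one_mem_filt F tl hd rk _
      · simp
    · rintro ⟨k, hk⟩ -
      dsimp only
      split_ifs with h
      · subst h
        apply neg_pow_mul_mem
        refine Submodule.subset_span ⟨[⟨e, ⟨i, (Finset.mem_Icc.mp hk).1,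
          (Finset.mem_Icc.mp hk).2⟩⟩], ?_, ?_⟩
        · simp [wt]
        · simp
      · simp
  · intro h
    rw [Polynomial.coeff_one, if_neg (by omega), zero_add]
    apply Finset.sum_eq_zero
    rintro ⟨k, hk⟩ -
    have := Finset.mem_Icc.mp hk
    rw [if_neg]
    dsimp only
    omega

theorem two_fN (a j : ℕ) (h : j ≤ a) : (2 * fN a j : ℤ) = 2 * j * a - j * (j - 1) := by
  unfold fN
  have h1 : j * (j - 1) / 2 ≤ j * a :=
    (Nat.div_le_self _ _).trans (Nat.mul_le_mul_left _ (by omega))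
  have h2 : 2 * (j * (j - 1) / 2) = j * (j - 1) :=
    Nat.mul_div_cancel' (Nat.even_mul_pred_self j).two_dvd
  have h3 : ((j * (j - 1) : ℕ) : ℤ) = j * (j - 1) := by
    cases j <;> simp
  rw [Nat.cast_sub h1, mul_sub]
  have h4 : (2 * ((j * (j - 1) / 2 : ℕ)) : ℤ) = j * (j - 1) := by
    rw [← h3]; exact_mod_cast h2
  rw [h4]; push_cast; ring

theorem fN_add (a b i k : ℕ) (h : i + b ≤ a) (hk : k ≤ b) :
    fN a i + fN b k ≤ fN a (i + k) := by
  have h1 := two_fN a i (by omega)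
  have h2 := two_fN b k hk
  have h3 := two_fN a (i + k) (by omega)
  have h4 : (k : ℤ) * (i + b) ≤ k * a := by
    exact_mod_cast Nat.mul_le_mul_left k h
  push_cast at h3
  zify
  nlinarith

/-- The inductive invariant. -/
def Good (a : ℕ) (es : List E) : Prop := ∀ j,
  mkA F tl hd rk (((es.map (Pe F tl hd rk)).prod).coeff j) ∈ filt F tl hd rk (fN a j) ∧
  (a < j → ((es.map (Pe F tl hd rk)).prod).coeff j = 0)

theorem good_step (hrank : IsRank tl hd rk) (e : E) (es : List E)
    (h : Good F tl hd rk (rk (hd e)) es) : Good F tl hd rk (rk (tl e)) (e :: es) := by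
  intro j
  have hr := hrank e
  have key : ∀ p : ℕ × ℕ, p.1 + p.2 = j → (p.1 + rk (hd e) ≤ rk (tl e) ∧ p.2 ≤ rk (hd e)) ∨
      (Pe F tl hd rk e).coeff p.1 * ((es.map (Pe F tl hd rk)).prod).coeff p.2 = 0 := by
    intro p hp
    by_cases h1 : len tl hd rk e < p.1
    · right; rw [(Pe_coeff F tl hd rk e p.1).2 h1, zero_mul]
    by_cases h2 : rk (hd e) < p.2
    · right; rw [(h p.2).2 h2, mul_zero]
    left
    unfold len at h1
    omega
  rw [List.map_cons, List.prod_cons, Polynomial.coeff_mul]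
  constructor
  · rw [map_sum]
    refine Submodule.sum_mem _ ?_
    intro p hp
    have hp := Finset.HasAntidiagonal.mem_antidiagonal.mp hp
    rcases key p hp with ⟨h1, h2⟩ | h0
    · rw [map_mul]
      have := fN_add _ _ _ _ h1 h2
      rw [hp] at this
      exact filt_mono F tl hd rk this
        (filt_mul F tl hd rk (Pe_coeff F tl hd rk e p.1).1 (h p.2).1)
    · rw [h0, map_zero]; exact Submodule.zero_mem _
  · intro hj
    apply Finset.sum_eq_zero
    intro p hp
    have hp := Finset.HasAntidiagonal.mem_antidiagonal.mp hp
    rcases key p hp with ⟨h1, h2⟩ | h0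
    · omega
    · exact h0

theorem good_tail (hrank : IsRank tl hd rk) (es : List E) : ∀ e, IsPathC tl hd e es →
    Good F tl hd rk (rk (hd e)) es := by
  induction es with
  | nil =>
    intro e _ j
    simp only [List.map_nil, List.prod_nil, Polynomial.coeff_one]
    constructor
    · split_ifs
      · simpa using one_mem_filt F tl hd rk _
      · simp
    · intro h
      rw [if_neg (by omega)]
  | cons e' es ih =>
    intro e h
    unfold IsPathC at h
    have h' := List.isChain_cons_cons.mp h
    rw [h'.1]
    exact good_step F tl hd rk hrank e' es (ih e' h'.2)

end GLG

/-- **Lemma 1.4.** Let `Γ` be a generalized layered graph. For every directed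
path `π = (e :: es)` and every `j` with `1 ≤ j ≤ l(π)`, the image of `e(π, j)` in `A(Γ)`
lies in the filtration subspace `A(Γ)_{f(|π|, j)}`, where `|π| = |t(π)|` and
`f(a,j) = ja - j(j-1)/2`. -/
theorem ePath_mem_filt (F : Type) [Field F] {V E : Type} (tl hd : E → V) (rk : V → ℕ)
    (hrank : GLG.IsRank tl hd rk)
    (e : E) (es : List E) (hpath : GLG.IsPathC tl hd e es)
    (j : ℕ) (hj1 : 1 ≤ j) (hj2 : j ≤ rk (tl e) - rk (GLG.pathDst hd e es)) :
    GLG.mkA F tl hd rk (GLG.eP F tl hd rk (e :: es) j) ∈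
      GLG.filt F tl hd rk (GLG.fN (rk (tl e)) j) := by
  exact GLG.neg_pow_mul_mem F tl hd rk j
    (GLG.good_step F tl hd rk hrank e es (GLG.good_tail F tl hd rk hrank es e hpath) j).1
end

section
/- Let Γ be a finite generalized layered graph with a unique minimal vertex * with |*| = 0. Then ε(B(Γ)), the set of all products e(v_1,k_1)⋯e(v_r,k_r) over words ((v_1,k_1),…,(v_r,k_r)) ∈ B(Γ), spans A(Γ) as an F-vector space. -/
open scoped BigOperators

namespace GLGP

/-- weight of a letter -/
def g (a j : ℕ) : ℕ := (∑ i ∈ Finset.range j, 2 * (a - i)) + 1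

theorem g_zero (a : ℕ) : g a 0 = 1 := by simp [g]

theorem g_succ (a j : ℕ) : g a (j + 1) = g a j + 2 * (a - j) := by
  simp [g, Finset.sum_range_succ]; ring

theorem g_add_le (a j d : ℕ) : g a (j + d) ≤ g a j + d * (2 * a) := by
  induction d with
  | zero => simp
  | succ d ih =>
    rw [← add_assoc, g_succ]
    have : (d + 1) * (2 * a) = d * (2 * a) + 2 * a := by ring
    omega

theorem le_g_add (a j d w : ℕ) (h : w + (j + d) ≤ a) : g a j + d * (2 * w + 2) ≤ g a (j + d) := by
  induction d with
  | zero => simp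
  | succ d ih =>
    rw [← add_assoc, g_succ]
    have := ih (by omega)
    have : (d + 1) * (2 * w + 2) = d * (2 * w + 2) + (2 * w + 2) := by ring
    omega

theorem g_glue (w k l : ℕ) : g (w + k) (k + l) + 1 = g (w + k) k + g w l := by
  induction l with
  | zero => simp [g_zero]
  | succ l ih =>
    rw [← add_assoc, g_succ, g_succ]
    omega

theorem g_mono_small (w j : ℕ) (hj : 1 ≤ j) : g w j ≤ j * (2 * w + 1) := by
  have := g_add_le w 0 j
  rw [g_zero, zero_add] at this
  have h2 : j * (2 * w + 1) = j * (2 * w) + j := by ring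
  omega

theorem exists_bad {α : Type} (R : α → α → Prop) (l : List α) (h : ¬ l.IsChain R) :
    ∃ l1 a b l2, l = l1 ++ a :: b :: l2 ∧ ¬ R a b := by
  induction l with
  | nil => simp at h
  | cons a l ih =>
    cases l with
    | nil => simp at h
    | cons b l =>
      by_cases hr : R a b
      · rw [List.isChain_cons_cons] at h
        obtain ⟨l1, x, y, l2, h1, h2⟩ := ih (fun hh => h ⟨hr, hh⟩)
        exact ⟨a :: l1, x, y, l2, by simp [h1], h2⟩
      · exact ⟨[], a, b, l, rfl, hr⟩

section abs
variable {F : Type} [Field F] {V : Type} {A : Type} [Ring A] [Algebra F A]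
  (rk : V → ℕ) (star : V) (ev : V → ℕ → A)

/-- admissible words -/
def Adm (b : List (V × ℕ)) : Prop := ∀ p ∈ b, p.1 ≠ star ∧ 1 ≤ p.2 ∧ p.2 ≤ rk p.1

/-- weight of a word -/
def W (b : List (V × ℕ)) : ℕ := (b.map fun p => g (rk p.1) p.2).sum

variable (F) in
/-- filtration -/
def Fil (n : ℕ) : Submodule F A :=
  Submodule.span F {x | ∃ b, Adm rk star b ∧ W rk b ≤ n ∧ x = (b.map fun p => ev p.1 p.2).prod}

theorem Fil_mono {n m : ℕ} (h : n ≤ m) : Fil F rk star ev n ≤ Fil F rk star ev m := by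
  apply Submodule.span_mono
  rintro x ⟨b, h1, h2, h3⟩
  exact ⟨b, h1, h2.trans h, h3⟩

theorem Fil_mem {n m : ℕ} (h : n ≤ m) {x : A} (hx : x ∈ Fil F rk star ev n) :
    x ∈ Fil F rk star ev m := Fil_mono rk star ev h hx

theorem Fil_word (b : List (V × ℕ)) (hb : Adm rk star b) :
    (b.map fun p => ev p.1 p.2).prod ∈ Fil F rk star ev (W rk b) :=
  Submodule.subset_span ⟨b, hb, le_rfl, rfl⟩

theorem Fil_one (n : ℕ) : (1 : A) ∈ Fil F rk star ev n :=
  Submodule.subset_span ⟨[], by simp [Adm], by simp [W], by simp⟩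

theorem Fil_mul {n m : ℕ} {x y : A} (hx : x ∈ Fil F rk star ev n) (hy : y ∈ Fil F rk star ev m) :
    x * y ∈ Fil F rk star ev (n + m) := by
  have h := Submodule.mul_mem_mul hx hy
  rw [Fil, Fil, Submodule.span_mul_span] at h
  refine Submodule.span_mono ?_ h
  rintro z ⟨x, ⟨b, h1, h2, h3⟩, y, ⟨b', h1', h2', h3'⟩, rfl⟩
  refine ⟨b ++ b', ?_, ?_, ?_⟩
  · intro p hp
    rcases List.mem_append.1 hp with hp | hp
    · exact h1 p hp
    · exact h1' p hp
  · simp only [W, List.map_append, List.sum_append] at *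
    omega
  · simp [h3, h3']

variable (h0 : ∀ v, ev v 0 = 1) (hbig : ∀ v j, rk v < j → ev v j = 0) (hs : rk star = 0)

include h0 hbig hs in
theorem Fil_ev (v : V) (j : ℕ) : ev v j ∈ Fil F rk star ev (g (rk v) j) := by
  rcases Nat.eq_zero_or_pos j with rfl | hj
  · rw [h0]; exact Fil_one _ _ _ _
  by_cases hjv : rk v < j
  · rw [hbig v j hjv]; exact Submodule.zero_mem _
  have hv : v ≠ star := by rintro rfl; omega
  have := Fil_word (F := F) rk star ev [(v, j)] (by
    intro p hp
    simp only [List.mem_singleton] at hp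
    subst hp
    exact ⟨hv, hj, by simpa using hjv⟩)
  simpa [W] using this

include h0 hbig hs in
theorem Fil_ev_small (v : V) (j : ℕ) : ev v j ∈ Fil F rk star ev (j * (2 * rk v + 1)) := by
  rcases Nat.eq_zero_or_pos j with rfl | hj
  · rw [h0]; exact Fil_one _ _ _ _
  exact Fil_mem _ _ _ (g_mono_small _ _ hj) (Fil_ev rk star ev h0 hbig hs v j)

include h0 hbig hs in
theorem Fil_c (v w : V) (c : ℕ → A)
    (hc : ∀ n, ev v n = ∑ p ∈ Finset.HasAntidiagonal.antidiagonal n, c p.1 * ev w p.2) (i : ℕ)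
    (hi : rk w + i ≤ rk v) : c i ∈ Fil F rk star ev (g (rk v) i) := by
  induction i using Nat.strong_induction_on with
  | _ i ih =>
    have h := hc i
    rw [Finset.Nat.sum_antidiagonal_eq_sum_range_succ (fun a b => c a * ev w b),
      Finset.sum_range_succ, Nat.sub_self, h0, mul_one] at h
    have h' : c i = ev v i - ∑ x ∈ Finset.range i, c x * ev w (i - x) := by
      rw [h]; abel
    rw [h']
    refine Submodule.sub_mem _ (Fil_ev rk star ev h0 hbig hs v i) (Submodule.sum_mem _ ?_)
    intro x hx
    rw [Finset.mem_range] at hx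
    refine Fil_mem _ _ _ ?_ (Fil_mul rk star ev (ih x hx (by omega))
      (Fil_ev_small rk star ev h0 hbig hs w (i - x)))
    have := le_g_add (rk v) x (i - x) (rk w) (by omega)
    rw [Nat.add_sub_cancel' hx.le] at this
    have : (i - x) * (2 * rk w + 2) = (i - x) * (2 * rk w + 1) + (i - x) := by ring
    omega

include h0 hbig hs in
theorem Fil_pair (v w : V) (c : ℕ → A) (hvw : rk w < rk v)
    (hc : ∀ n, ev v n = ∑ p ∈ Finset.HasAntidiagonal.antidiagonal n, c p.1 * ev w p.2)
    (hcb : ∀ i, rk v < rk w + i → c i = 0) (k l : ℕ) (hk : rk v = rk w + k) :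
    ∃ n, n + 1 = g (rk v) k + g (rk w) l ∧ ev v k * ev w l ∈ Fil F rk star ev n := by
  have hglue := g_glue (rk w) k l
  rw [← hk] at hglue
  refine ⟨g (rk v) (k + l), hglue, ?_⟩
  have e1 : ev v k = ∑ x ∈ Finset.range k, c x * ev w (k - x) + c k := by
    rw [hc k, Finset.Nat.sum_antidiagonal_eq_sum_range_succ (fun a b => c a * ev w b),
      Finset.sum_range_succ, Nat.sub_self, h0, mul_one]
  have e2 : ev v (k + l) = ∑ x ∈ Finset.range k, c x * ev w (k + l - x) + c k * ev w l := by
    rw [hc (k + l), Finset.Nat.sum_antidiagonal_eq_sum_range_succ (fun a b => c a * ev w b)]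
    rw [show (k + l).succ = (k + 1) + l by omega, Finset.sum_range_add, Finset.sum_range_succ]
    rw [Finset.sum_eq_zero (s := Finset.range l), add_zero, Nat.add_sub_cancel_left]
    intro i _
    rw [hcb _ (by omega), zero_mul]
  have e3 : ev v k * ev w l = ev v (k + l) - ∑ x ∈ Finset.range k, c x * ev w (k + l - x)
      + ∑ x ∈ Finset.range k, c x * ev w (k - x) * ev w l := by
    rw [e2, e1, add_mul, Finset.sum_mul]; abel
  rw [e3]
  refine Submodule.add_mem _ (Submodule.sub_mem _ (Fil_ev rk star ev h0 hbig hs v _)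
    (Submodule.sum_mem _ ?_)) (Submodule.sum_mem _ ?_)
  · intro x hx
    rw [Finset.mem_range] at hx
    refine Fil_mem _ _ _ ?_ (Fil_mul rk star ev
      (Fil_c rk star ev h0 hbig hs v w c hc x (by omega))
      (Fil_ev rk star ev h0 hbig hs w (k + l - x)))
    have h1 := le_g_add (rk v) x (k - x) (rk w) (by omega)
    have h2 := g_add_le (rk w) l (k - x)
    rw [Nat.add_sub_cancel' hx.le] at h1
    rw [show l + (k - x) = k + l - x by omega] at h2
    have : (k - x) * (2 * rk w + 2) = (k - x) * (2 * rk w) + 2 * (k - x) := by ring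
    omega
  · intro x hx
    rw [Finset.mem_range] at hx
    refine Fil_mem _ _ _ ?_ (Fil_mul rk star ev (Fil_mul rk star ev
      (Fil_c rk star ev h0 hbig hs v w c hc x (by omega))
      (Fil_ev_small rk star ev h0 hbig hs w (k - x))) (Fil_ev rk star ev h0 hbig hs w l))
    have h1 := le_g_add (rk v) x (k - x) (rk w) (by omega)
    rw [Nat.add_sub_cancel' hx.le] at h1
    have : (k - x) * (2 * rk w + 2) = (k - x) * (2 * rk w + 1) + (k - x) := by ring
    omega

include h0 hbig hs in
theorem Fil_le (Rch : V → V → Prop) (hlt : ∀ v w, Rch v w → rk w < rk v)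
    (hR : ∀ v w, Rch v w → ∃ c : ℕ → A,
      (∀ n, ev v n = ∑ p ∈ Finset.HasAntidiagonal.antidiagonal n, c p.1 * ev w p.2) ∧
      (∀ i, rk v < rk w + i → c i = 0)) (n : ℕ) :
    Fil F rk star ev n ≤ Submodule.span F {x | ∃ b : List (V × ℕ), Adm rk star b ∧
      b.IsChain (fun p q => ¬(Rch p.1 q.1 ∧ p.2 = rk p.1 - rk q.1)) ∧
      x = (b.map fun p => ev p.1 p.2).prod} := by
  induction n using Nat.strong_induction_on with
  | _ n ih =>
    refine Submodule.span_le.2 ?_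
    rintro x ⟨b, hb, hw, rfl⟩
    by_cases hch : b.IsChain (fun p q => ¬(Rch p.1 q.1 ∧ p.2 = rk p.1 - rk q.1))
    · exact Submodule.subset_span ⟨b, hb, hch, rfl⟩
    obtain ⟨l1, p, q, l2, rfl, hpq⟩ := exists_bad _ _ hch
    rw [not_not] at hpq
    obtain ⟨hr, hk⟩ := hpq
    have hlt' := hlt _ _ hr
    obtain ⟨c, hc, hcb⟩ := hR _ _ hr
    obtain ⟨m, hm, hmem⟩ := Fil_pair (F := F) rk star ev h0 hbig hs p.1 q.1 c hlt' hc hcb p.2 q.2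
      (by omega)
    have hl1 := Fil_word (F := F) rk star ev l1 (fun r hr => hb r (by simp [hr]))
    have hl2 := Fil_word (F := F) rk star ev l2 (fun r hr => hb r (by simp [hr]))
    have key := Fil_mul rk star ev (Fil_mul rk star ev hl1 hmem) hl2
    have hW : W rk (l1 ++ p :: q :: l2)
        = W rk l1 + (g (rk p.1) p.2 + g (rk q.1) q.2) + W rk l2 := by
      simp [W]; ring
    have := ih (W rk l1 + m + W rk l2) (by omega) key
    simpa [mul_assoc] using this

end abs

section paths
variable {V E : Type} (F : Type) [Field F] (tl hd : E → V) (rk : V → ℕ)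

/-- paths from `v` to `w` -/
def Pth : V → List E → V → Prop
  | v, [], w => v = w
  | v, e :: es, w => tl e = v ∧ Pth (hd e) es w

theorem Pth_append {es es' : List E} {u v w : V} (h : Pth tl hd u es v) (h' : Pth tl hd v es' w) :
    Pth tl hd u (es ++ es') w := by
  induction es generalizing u with
  | nil => cases h; exact h'
  | cons e es ih => exact ⟨h.1, ih h.2⟩

theorem Pth_iff (e : E) (es : List E) (v w : V) :
    Pth tl hd v (e :: es) w ↔ GLG.IsPathC tl hd e es ∧ tl e = v ∧ GLG.pathDst hd e es = w := by
  induction es generalizing e v with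
  | nil =>
    have : GLG.IsPathC tl hd e [] := List.isChain_singleton e
    simp [Pth, this, GLG.pathDst]
  | cons e' es ih =>
    rw [Pth, ih]
    have hch : GLG.IsPathC tl hd e (e' :: es) ↔ hd e = tl e' ∧ GLG.IsPathC tl hd e' es :=
      List.isChain_cons_cons
    rw [hch]
    simp only [GLG.pathDst]
    rw [List.getLast_cons (List.cons_ne_nil e' es)]
    constructor
    · rintro ⟨a, b, c, d⟩; exact ⟨⟨c.symm, b⟩, a, d⟩
    · rintro ⟨⟨c, b⟩, a, d⟩; exact ⟨a, b, c.symm, d⟩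

theorem Pe_coeff_zero (e : E) : (GLG.Pe F tl hd rk e).coeff 0 = 1 := by
  rw [GLG.Pe, Polynomial.coeff_add, Polynomial.finsetSum_coeff, Finset.sum_eq_zero]
  · simp
  · intro j _
    have := (Finset.mem_Icc.mp j.2).1
    rw [Polynomial.coeff_C_mul_X_pow, if_neg (by omega)]

theorem Pe_coeff_big (e : E) (n : ℕ) (h : GLG.len tl hd rk e < n) :
    (GLG.Pe F tl hd rk e).coeff n = 0 := by
  rw [GLG.Pe, Polynomial.coeff_add, Polynomial.finsetSum_coeff, Finset.sum_eq_zero]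
  · rw [Polynomial.coeff_one, if_neg (by omega), add_zero]
  · intro j _
    have := (Finset.mem_Icc.mp j.2).2
    rw [Polynomial.coeff_C_mul_X_pow, if_neg (by omega)]

theorem Pe_coeff (s : GLG.ESharp tl hd rk) :
    (GLG.Pe F tl hd rk s.1).coeff s.2.1 = (-1) ^ s.2.1 * FreeAlgebra.ι F s := by
  obtain ⟨e, n, h1, h2⟩ := s
  simp only
  rw [GLG.Pe, Polynomial.coeff_add, Polynomial.finsetSum_coeff,
    Finset.sum_eq_single (⟨n, Finset.mem_Icc.2 ⟨h1, h2⟩⟩ : {x // x ∈ Finset.Icc 1 (GLG.len tl hd rk e)})]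
  · rw [Polynomial.coeff_C_mul_X_pow, if_pos rfl, Polynomial.coeff_one, if_neg (by omega), zero_add]
  · intro j _ hj
    rw [Polynomial.coeff_C_mul_X_pow, if_neg]
    intro h
    exact hj (Subtype.ext h.symm)
  · simp

theorem eP_nil (n : ℕ) : GLG.eP F tl hd rk [] n = if n = 0 then 1 else 0 := by
  simp only [GLG.eP, List.map_nil, List.prod_nil, Polynomial.coeff_one]
  split_ifs with h
  · simp [h]
  · simp

theorem eP_append (es es' : List E) (n : ℕ) : GLG.eP F tl hd rk (es ++ es') n =
    ∑ p ∈ Finset.HasAntidiagonal.antidiagonal n, GLG.eP F tl hd rk es p.1 * GLG.eP F tl hd rk es' p.2 := by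
  simp only [GLG.eP, List.map_append, List.prod_append, Polynomial.coeff_mul, Finset.mul_sum]
  refine Finset.sum_congr rfl fun p hp => ?_
  rw [← Finset.HasAntidiagonal.mem_antidiagonal.1 hp, pow_add]
  have : ∀ x : FreeAlgebra F (GLG.ESharp tl hd rk), x * (-1) ^ p.2 = (-1) ^ p.2 * x :=
    fun x => ((Commute.neg_one_right x).pow_right p.2).eq
  simp only [mul_assoc]
  rw [← mul_assoc (Polynomial.coeff _ p.1) ((-1) ^ p.2), this]
  simp only [mul_assoc]

theorem eP_zero (es : List E) : GLG.eP F tl hd rk es 0 = 1 := by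
  induction es with
  | nil => simp [eP_nil]
  | cons e es ih =>
    rw [← List.singleton_append, eP_append]
    simp [ih]
    simp [GLG.eP, Pe_coeff_zero]

variable (hrank : GLG.IsRank tl hd rk)

include hrank in
theorem Pth_le {es : List E} {v w : V} (h : Pth tl hd v es w) : rk w ≤ rk v := by
  induction es generalizing v with
  | nil => cases h; rfl
  | cons e es ih =>
    have := ih h.2
    have := hrank e
    rw [h.1] at this
    omega

include hrank in
theorem eP_big {es : List E} {v w : V} (h : Pth tl hd v es w) (n : ℕ) (hn : rk v < rk w + n) :
    GLG.eP F tl hd rk es n = 0 := by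
  induction es generalizing v n with
  | nil => cases h; rw [eP_nil, if_neg (by omega)]
  | cons e es ih =>
    rw [← List.singleton_append, eP_append]
    refine Finset.sum_eq_zero fun p hp => ?_
    have hp := Finset.HasAntidiagonal.mem_antidiagonal.1 hp
    have hr := hrank e
    have hle := Pth_le tl hd rk hrank h.2
    by_cases hb : rk (hd e) < rk w + p.2
    · rw [ih h.2 _ hb, mul_zero]
    · have hl : GLG.len tl hd rk e < p.1 := by
        rw [GLG.len, h.1]
        rw [h.1] at hr
        omega
      simp [GLG.eP, Pe_coeff_big F tl hd rk e _ hl]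

include hrank in
theorem mk_eq {es es' : List E} {v w : V} (h : Pth tl hd v es w) (h' : Pth tl hd v es' w) (n : ℕ) :
    GLG.mkA F tl hd rk (GLG.eP F tl hd rk es n) = GLG.mkA F tl hd rk (GLG.eP F tl hd rk es' n) := by
  by_cases hn : n = 0
  · subst hn; rw [eP_zero, eP_zero]
  by_cases hb : rk v < rk w + n
  · rw [eP_big F tl hd rk hrank h n hb, eP_big F tl hd rk hrank h' n hb]
  have aux : ∀ (e : E) (es : List E), Pth tl hd v (e :: es) w → rk w < rk v := by
    intro e es h
    have := Pth_le tl hd rk hrank h.2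
    have h3 := hrank e
    rw [h.1] at h3
    omega
  cases es with
  | nil => cases h; omega
  | cons e es =>
    cases es' with
    | nil => cases h'; omega
    | cons e' es' =>
      rw [Pth_iff] at h h'
      refine RingQuot.mkAlgHom_rel F ⟨e, es, e', es', n, h.1, h'.1, h.2.1.trans h'.2.1.symm,
        h.2.2.trans h'.2.2.symm, by omega, ?_, rfl, rfl⟩
      rw [h.2.1, h.2.2]
      omega

end paths

end GLGP

/-- **Proposition 2.3.** Let `Γ` be a finite generalized layered graph with a
unique minimal vertex `*` with `|*| = 0`, and let `e(v,j)` be defined from the fixed paths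
`π_v` as in the paper.  Then `ε(𝐁(Γ))`, the set of products `e(v₁,k₁)⋯e(v_r,k_r)` over the
words `((v₁,k₁),…,(v_r,k_r)) ∈ 𝐁(Γ)` (with `v_i ∈ V₊`, `1 ≤ k_i ≤ |v_i|`, and no
`(v_j,k_j) ⋗ (v_{j+1},k_{j+1})`), spans `A(Γ)` as an `F`-vector space. -/
theorem epsilonB_spans (F : Type) [Field F] {V E : Type} [Fintype V] [Fintype E]
    (tl hd : E → V) (rk : V → ℕ) (hrank : GLG.IsRank tl hd rk)
    (star : V) (hstar0 : rk star = 0)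
    (hmin : ∀ v : V, (∀ e : E, tl e ≠ v) ↔ v = star)
    (sel : V → E) (hsel : ∀ v : V, v ≠ star → tl (sel v) = v)
    (pathOf : V → List E)
    (hpathOf0 : pathOf star = [])
    (hpathOfS : ∀ v : V, v ≠ star → pathOf v = sel v :: pathOf (hd (sel v))) :
    Submodule.span F {x : GLG.AGamma F tl hd rk | ∃ b : List (V × ℕ),
        (∀ p ∈ b, p.1 ≠ star ∧ 1 ≤ p.2 ∧ p.2 ≤ rk p.1) ∧
        b.Chain' (fun p q => ¬(GLG.Reaches tl hd p.1 q.1 ∧ p.2 = rk p.1 - rk q.1)) ∧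
        x = (b.map fun p =>
          GLG.mkA F tl hd rk (GLG.eP F tl hd rk (pathOf p.1) p.2)).prod} = ⊤ := by
  have hP : ∀ n v, rk v = n → GLGP.Pth tl hd v (pathOf v) star := by
    intro n
    induction n using Nat.strong_induction_on with
    | _ n ih =>
      intro v hv
      by_cases hvs : v = star
      · subst hvs; rw [hpathOf0]; rfl
      · rw [hpathOfS v hvs]
        refine ⟨hsel v hvs, ih _ ?_ _ rfl⟩
        have := hrank (sel v)
        rw [hsel v hvs] at this
        omega
  have hP' : ∀ v, GLGP.Pth tl hd v (pathOf v) star := fun v => hP _ v rfl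
  set ev : V → ℕ → GLG.AGamma F tl hd rk :=
    fun v j => GLG.mkA F tl hd rk (GLG.eP F tl hd rk (pathOf v) j) with hev
  have h0 : ∀ v, ev v 0 = 1 := fun v => by simp [hev, GLGP.eP_zero]
  have hbig : ∀ v j, rk v < j → ev v j = 0 := fun v j h => by
    simp only [hev]
    rw [GLGP.eP_big F tl hd rk hrank (hP' v) j (by omega), map_zero]
  have hconv : ∀ v w es, GLGP.Pth tl hd v es w → ∀ n, ev v n =
      ∑ p ∈ Finset.HasAntidiagonal.antidiagonal n, GLG.mkA F tl hd rk (GLG.eP F tl hd rk es p.1) * ev w p.2 := by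
    intro v w es h n
    simp only [hev]
    rw [GLGP.mk_eq F tl hd rk hrank (hP' v) (GLGP.Pth_append tl hd h (hP' w)),
      GLGP.eP_append, map_sum]
    simp
  have hle := GLGP.Fil_le (F := F) rk star ev h0 hbig hstar0 (GLG.Reaches tl hd)
    (by
      rintro v w ⟨e, es, h⟩
      have h' := (GLGP.Pth_iff tl hd e es v w).2 ⟨h.1, h.2.1, h.2.2⟩
      have h1 := GLGP.Pth_le tl hd rk hrank h'.2
      have h2 := hrank e
      rw [h'.1] at h2
      omega)
    (by
      rintro v w ⟨e, es, h⟩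
      have h' := (GLGP.Pth_iff tl hd e es v w).2 ⟨h.1, h.2.1, h.2.2⟩
      refine ⟨fun i => GLG.mkA F tl hd rk (GLG.eP F tl hd rk (e :: es) i), hconv v w _ h', ?_⟩
      intro i hi
      beta_reduce
      rw [GLGP.eP_big F tl hd rk hrank h' i hi, map_zero])
  have hall : ∀ y : FreeAlgebra F (GLG.ESharp tl hd rk),
      ∃ n, GLG.mkA F tl hd rk y ∈ GLGP.Fil F rk star ev n := by
    intro y
    induction y using FreeAlgebra.induction with
    | grade0 r =>
      refine ⟨0, ?_⟩
      rw [AlgHom.commutes, Algebra.algebraMap_eq_smul_one]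
      exact Submodule.smul_mem _ _ (GLGP.Fil_one _ _ _ _)
    | grade1 s =>
      have hs : GLGP.Pth tl hd (tl s.1) [s.1] (hd s.1) := ⟨rfl, rfl⟩
      have := GLGP.Fil_c (F := F) rk star ev h0 hbig hstar0 (tl s.1) (hd s.1)
        (fun i => GLG.mkA F tl hd rk (GLG.eP F tl hd rk [s.1] i)) (hconv _ _ _ hs) s.2.1 (by
        have h1 := s.2.2.2
        have h2 := hrank s.1
        unfold GLG.len at h1
        omega)
      have heq : GLG.eP F tl hd rk [s.1] s.2.1 = FreeAlgebra.ι F s := by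
        simp only [GLG.eP, List.map_cons, List.map_nil, List.prod_cons, List.prod_nil, mul_one]
        rw [GLGP.Pe_coeff, ← mul_assoc, ← pow_add, ← two_mul, pow_mul]
        simp
      rw [heq] at this
      exact ⟨_, this⟩
    | mul a b iha ihb =>
      obtain ⟨n, hn⟩ := iha
      obtain ⟨m, hm⟩ := ihb
      exact ⟨n + m, by rw [map_mul]; exact GLGP.Fil_mul _ _ _ hn hm⟩
    | add a b iha ihb =>
      obtain ⟨n, hn⟩ := iha
      obtain ⟨m, hm⟩ := ihb
      refine ⟨n + m, ?_⟩
      rw [map_add]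
      exact Submodule.add_mem _ (GLGP.Fil_mem _ _ _ (by omega) hn)
        (GLGP.Fil_mem _ _ _ (by omega) hm)
  rw [eq_top_iff]
  intro x _
  obtain ⟨y, rfl⟩ := RingQuot.mkAlgHom_surjective F (GLG.rel F tl hd rk) x
  obtain ⟨n, hn⟩ := hall y
  exact hle n hn
end

section
/- Let Γ be a finite generalized layered graph with a unique minimal vertex * with |*| = 0. Then the family (ε(b))_{b ∈ B(Γ)} of products e(v_1,k_1)⋯e(v_r,k_r), indexed by words in B(Γ), is an F-vector-space basis of A(Γ); in particular ε is injective on B(Γ) and these products are linearly independent. -/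
open scoped BigOperators

namespace GLGDia

variable {F : Type} [Field F] {L : Type}

/-- word as element -/
noncomputable def word (F : Type) [Field F] {L : Type} (w : List L) : FreeAlgebra F L :=
  (w.map (FreeAlgebra.ι F)).prod

/-- total weight -/
def W (wt : L → ℤ) (w : List L) : ℤ := (w.map wt).sum

/-- filtration of the free algebra -/
noncomputable def Tf (F : Type) [Field F] {L : Type} (wt : L → ℤ) (z : ℤ) :
    Submodule F (FreeAlgebra F L) :=
  Submodule.span F {t | ∃ w : List L, W wt w ≤ z ∧ t = word F w}

/-- filtration of the ideal -/
noncomputable def Jf (wt : L → ℤ) (R : L → L → Prop) (ρ : L → L → FreeAlgebra F L) (z : ℤ) :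
    Submodule F (FreeAlgebra F L) :=
  Submodule.span F {t | ∃ (a : List L) (x y : L) (b : List L), R x y ∧
    W wt a + wt x + wt y + W wt b ≤ z ∧ t = word F a * ρ x y * word F b}

lemma word_append (a b : List L) : word F (a ++ b) = word F a * word F b := by
  simp [word]

lemma word_cons (x : L) (b : List L) : word F (x :: b) = FreeAlgebra.ι F x * word F b := by
  simp [word]

lemma word_nil : word F ([] : List L) = 1 := by
  simp [word]

lemma W_append (wt : L → ℤ) (a b : List L) : W wt (a ++ b) = W wt a + W wt b := by
  simp [W]

lemma W_cons (wt : L → ℤ) (x : L) (b : List L) : W wt (x :: b) = wt x + W wt b := by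
  simp [W]

lemma W_nil (wt : L → ℤ) : W wt [] = 0 := by
  simp [W]

lemma W_nonneg {wt : L → ℤ} (h0 : ∀ x, 0 ≤ wt x) (a : List L) : 0 ≤ W wt a := by
  induction a with
  | nil => simp [W]
  | cons x a ih => rw [W_cons]; linarith [h0 x]

lemma Tf_mono {wt : L → ℤ} {y z : ℤ} (h : y ≤ z) : Tf F wt y ≤ Tf F wt z := by
  apply Submodule.span_mono
  rintro t ⟨w, hw, rfl⟩
  exact ⟨w, hw.trans h, rfl⟩

lemma Jf_mono {wt : L → ℤ} {R : L → L → Prop} {ρ : L → L → FreeAlgebra F L} {y z : ℤ}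
    (h : y ≤ z) : Jf wt R ρ y ≤ Jf wt R ρ z := by
  apply Submodule.span_mono
  rintro t ⟨a, x, y, b, h1, h2, rfl⟩
  exact ⟨a, x, y, b, h1, h2.trans h, rfl⟩

lemma word_mem {wt : L → ℤ} {z : ℤ} {w : List L} (h : W wt w ≤ z) : word F w ∈ Tf F wt z :=
  Submodule.subset_span ⟨w, h, rfl⟩

lemma ι_mem {wt : L → ℤ} {z : ℤ} {x : L} (h : wt x ≤ z) : FreeAlgebra.ι F x ∈ Tf F wt z := by
  have := word_mem (F := F) (wt := wt) (w := [x]) (z := z) (by simpa [W] using h)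
  simpa [word] using this

lemma one_mem_Tf {wt : L → ℤ} {z : ℤ} (h : 0 ≤ z) : (1 : FreeAlgebra F L) ∈ Tf F wt z := by
  have := word_mem (F := F) (wt := wt) (w := []) (z := z) (by simpa [W] using h)
  simpa [word] using this

lemma Tf_mul {wt : L → ℤ} {y z u : ℤ} {s t : FreeAlgebra F L} (hs : s ∈ Tf F wt y)
    (ht : t ∈ Tf F wt z) (h : y + z ≤ u) : s * t ∈ Tf F wt u := by
  have := Submodule.mul_mem_mul hs ht
  rw [Tf, Tf, Submodule.span_mul_span] at this
  refine Submodule.span_mono ?_ this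
  rintro _ ⟨_, ⟨a, ha, rfl⟩, _, ⟨b, hb, rfl⟩, rfl⟩
  exact ⟨a ++ b, by rw [W_append]; linarith, by simp only [word_append]⟩

lemma Tf_mul_Jf {wt : L → ℤ} {R : L → L → Prop} {ρ : L → L → FreeAlgebra F L}
    {y z u : ℤ} {s t : FreeAlgebra F L} (hs : s ∈ Tf F wt y)
    (ht : t ∈ Jf wt R ρ z) (h : y + z ≤ u) : s * t ∈ Jf wt R ρ u := by
  have := Submodule.mul_mem_mul hs ht
  rw [Tf, Jf, Submodule.span_mul_span] at this
  refine Submodule.span_mono ?_ this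
  rintro _ ⟨_, ⟨a, ha, rfl⟩, _, ⟨b, x, y, c, h1, h2, rfl⟩, rfl⟩
  exact ⟨a ++ b, x, y, c, h1, by rw [W_append]; linarith, by simp only [word_append, mul_assoc]⟩

lemma Jf_mul_Tf {wt : L → ℤ} {R : L → L → Prop} {ρ : L → L → FreeAlgebra F L}
    {y z u : ℤ} {s t : FreeAlgebra F L} (hs : s ∈ Jf wt R ρ y)
    (ht : t ∈ Tf F wt z) (h : y + z ≤ u) : s * t ∈ Jf wt R ρ u := by
  have := Submodule.mul_mem_mul hs ht
  rw [Tf, Jf, Submodule.span_mul_span] at this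
  refine Submodule.span_mono ?_ this
  rintro _ ⟨_, ⟨b, x, y, c, h1, h2, rfl⟩, _, ⟨a, ha, rfl⟩, rfl⟩
  exact ⟨b, x, y, c ++ a, h1, by rw [W_append]; linarith, by simp only [word_append, mul_assoc]⟩

lemma ρ_mem {wt : L → ℤ} {R : L → L → Prop} {ρ : L → L → FreeAlgebra F L}
    {x y : L} (h : R x y) {z : ℤ} (hz : wt x + wt y ≤ z) : ρ x y ∈ Jf wt R ρ z :=
  Submodule.subset_span ⟨[], x, y, [], h, by simpa [W] using hz, by simp [word]⟩

lemma exists_Tf (wt : L → ℤ) (t : FreeAlgebra F L) : ∃ z, t ∈ Tf F wt z := by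
  induction t using FreeAlgebra.induction with
  | grade0 r =>
    refine ⟨0, ?_⟩
    rw [Algebra.algebraMap_eq_smul_one]
    exact Submodule.smul_mem _ _ (one_mem_Tf le_rfl)
  | grade1 x => exact ⟨_, ι_mem le_rfl⟩
  | mul a b ha hb =>
    obtain ⟨y, hy⟩ := ha
    obtain ⟨z, hz⟩ := hb
    exact ⟨y + z, Tf_mul hy hz le_rfl⟩
  | add a b ha hb =>
    obtain ⟨y, hy⟩ := ha
    obtain ⟨z, hz⟩ := hb
    exact ⟨max y z, add_mem (Tf_mono (le_max_left _ _) hy) (Tf_mono (le_max_right _ _) hz)⟩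

section dia

variable {wt : L → ℤ} {R : L → L → Prop} {ρ : L → L → FreeAlgebra F L}
  (h0 : ∀ x, 0 ≤ wt x)
  (H1 : ∀ x y, R x y → ρ x y - FreeAlgebra.ι F x * FreeAlgebra.ι F y ∈ Tf F wt (wt x + wt y - 1))
  (H2 : ∀ x y z, R x y → R y z →
    ρ x y * FreeAlgebra.ι F z - FreeAlgebra.ι F x * ρ y z ∈ Jf wt R ρ (wt x + wt y + wt z - 1))

include H1 in
lemma lead {a b : List L} {x y : L} (h : R x y) :
    word F a * ρ x y * word F b - word F (a ++ x :: y :: b)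
      ∈ Tf F wt (W wt a + wt x + wt y + W wt b - 1) := by
  have e : word F a * ρ x y * word F b - word F (a ++ x :: y :: b) =
      word F a * (ρ x y - FreeAlgebra.ι F x * FreeAlgebra.ι F y) * word F b := by
    simp only [word_append, word_cons]; noncomm_ring
  rw [e]
  exact Tf_mul (Tf_mul (word_mem le_rfl) (H1 x y h) le_rfl) (word_mem le_rfl) (by linarith)

include H1 in
lemma Jf_le_Tf (z : ℤ) : Jf wt R ρ z ≤ Tf F wt z := by
  refine Submodule.span_le.2 ?_
  rintro _ ⟨a, x, y, b, h, hz, rfl⟩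
  have := add_mem (Tf_mono (by linarith) (lead H1 (a := a) (b := b) h))
    (word_mem (F := F) (wt := wt) (w := a ++ x :: y :: b) (z := z)
      (by simp only [W_append, W_cons]; linarith))
  simpa using this

include H1 H2 in
lemma two_decomp_aux {a b c : List L} {x y x' y' : L} (h : R x y) (h' : R x' y')
    (e : x :: y :: b = a ++ x' :: y' :: c) :
    ρ x y * word F b - word F a * ρ x' y' * word F c
      ∈ Jf wt R ρ (wt x + wt y + W wt b - 1) := by
  match a, e with
  | [], e =>
    simp only [List.nil_append, List.cons.injEq] at e
    obtain ⟨rfl, rfl, rfl⟩ := e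
    simp [word_nil]
  | [p], e =>
    simp only [List.cons_append, List.nil_append, List.cons.injEq] at e
    obtain ⟨rfl, rfl, rfl⟩ := e
    have := Jf_mul_Tf (H2 x y y' h h') (word_mem (F := F) (w := c) le_rfl)
      (u := wt x + wt y + W wt (y' :: c) - 1) (by rw [W_cons]; linarith)
    convert this using 1
    simp only [word_cons, word_nil]; noncomm_ring
  | p :: p' :: a, e =>
    simp only [List.cons_append, List.cons.injEq] at e
    obtain ⟨rfl, rfl, rfl⟩ := e
    have k1 := Jf_mul_Tf (Jf_mul_Tf (Jf_mul_Tf (ρ_mem (ρ := ρ) h le_rfl)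
      (word_mem (F := F) (w := a) le_rfl) le_rfl)
      (H1 x' y' h') le_rfl) (word_mem (F := F) (w := c) le_rfl)
      (u := wt x + wt y + W wt (a ++ x' :: y' :: c) - 1)
      (by simp only [W_append, W_cons]; linarith)
    have k2 := Jf_mul_Tf (Tf_mul_Jf (Tf_mul (H1 x y h)
      (word_mem (F := F) (w := a) le_rfl) le_rfl)
      (ρ_mem (ρ := ρ) h' le_rfl) le_rfl) (word_mem (F := F) (w := c) le_rfl)
      (u := wt x + wt y + W wt (a ++ x' :: y' :: c) - 1)
      (by simp only [W_append, W_cons]; linarith)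
    convert sub_mem k2 k1 using 1
    simp only [word_append, word_cons]; noncomm_ring

include H1 H2 in
lemma two_decomp {a b a' b' : List L} {x y x' y' : L} (h : R x y) (h' : R x' y')
    (e : a ++ x :: y :: b = a' ++ x' :: y' :: b') :
    word F a * ρ x y * word F b - word F a' * ρ x' y' * word F b'
      ∈ Jf wt R ρ (W wt a + wt x + wt y + W wt b - 1) := by
  rcases List.append_eq_append_iff.1 e with ⟨c, rfl, hc⟩ | ⟨c, rfl, hc⟩
  · have := Tf_mul_Jf (word_mem (F := F) (w := a) le_rfl) (two_decomp_aux H1 H2 h h' hc)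
      (u := W wt a + wt x + wt y + W wt b - 1) (by linarith)
    convert this using 1
    simp only [word_append]; noncomm_ring
  · have hw := congrArg (W wt) hc
    simp only [W_append, W_cons] at hw
    have := neg_mem (Tf_mul_Jf (word_mem (F := F) (w := a') le_rfl)
      (two_decomp_aux H1 H2 h' h hc)
      (u := W wt (a' ++ c) + wt x + wt y + W wt b - 1) (by rw [W_append]; linarith))
    convert this using 1
    simp only [word_append]; noncomm_ring

/-- reducible -/
def Red (R : L → L → Prop) (w : List L) : Prop :=
  ∃ (a : List L) (x y : L) (b : List L), R x y ∧ w = a ++ x :: y :: b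

lemma red_or (w : List L) : Red R w ∨ w.IsChain (fun x y => ¬ R x y) := by
  by_cases h : w.IsChain (fun x y => ¬ R x y)
  · exact Or.inr h
  · left
    rw [List.isChain_iff_forall_rel_of_append_cons_cons] at h
    push Not at h
    obtain ⟨x, y, a, b, e, h⟩ := h
    exact ⟨a, x, y, b, h, e⟩

lemma not_red {w : List L} (h : w.IsChain (fun x y => ¬ R x y)) : ¬ Red R w := by
  rintro ⟨a, x, y, b, h', e⟩
  exact List.isChain_iff_forall_rel_of_append_cons_cons.1 h e h'

lemma basis_word (w : List L) :
    FreeAlgebra.basisFreeMonoid F L (FreeMonoid.ofList w) = word F w := by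
  simp only [FreeAlgebra.basisFreeMonoid, Module.Basis.map_apply, Finsupp.coe_basisSingleOne]
  rw [LinearEquiv.symm_apply_eq]
  have : FreeAlgebra.equivMonoidAlgebraFreeMonoid (word F w) =
      MonoidAlgebra.of F (FreeMonoid L) (FreeMonoid.ofList w) := by
    induction w with
    | nil => simp [word_nil]; rfl
    | cons x w ih =>
      rw [word_cons, map_mul, ih, FreeMonoid.ofList_cons, map_mul]
      congr 1
      simp [FreeAlgebra.equivMonoidAlgebraFreeMonoid]
  simp only [LinearEquiv.trans_apply, AlgEquiv.toLinearEquiv_apply]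
  rw [this]
  simp

open Classical in
/-- a coordinate functional -/
lemma exists_coord (w : List L) : ∃ f : FreeAlgebra F L →ₗ[F] F,
    ∀ w', f (word F w') = if w' = w then 1 else 0 := by
  refine ⟨(FreeAlgebra.basisFreeMonoid F L).coord (FreeMonoid.ofList w), fun w' => ?_⟩
  rw [← basis_word, Module.Basis.coord_apply, Module.Basis.repr_self, Finsupp.single_apply]
  simp

include h0 in
lemma Jf_neg {z : ℤ} (hz : z < 0) : Jf wt R ρ z = ⊥ := by
  rw [eq_bot_iff]
  refine Submodule.span_le.2 ?_
  rintro _ ⟨a, x, y, b, h, h', rfl⟩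
  linarith [W_nonneg h0 a, W_nonneg h0 b, h0 x, h0 y]

include H1 H2 in
lemma descend {z : ℤ} {t : FreeAlgebra F L} (ht : t ∈ Jf wt R ρ z)
    (hB : t ∈ Submodule.span F (word F '' {w | w.IsChain (fun x y => ¬ R x y)})) :
    t ∈ Jf wt R ρ (z - 1) := by
  classical
  have hσ : ∃ σ : List L → FreeAlgebra F L, ∀ w, Red R w → ∃ (a : List L) (x y : L) (b : List L),
      R x y ∧ w = a ++ x :: y :: b ∧ σ w = word F a * ρ x y * word F b := by
    have : ∀ w : List L, ∃ s : FreeAlgebra F L, Red R w → ∃ (a : List L) (x y : L) (b : List L),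
      R x y ∧ w = a ++ x :: y :: b ∧ s = word F a * ρ x y * word F b := by
      intro w
      by_cases h : Red R w
      · obtain ⟨a, x, y, b, h1, h2⟩ := h
        exact ⟨_, fun _ => ⟨a, x, y, b, h1, h2, rfl⟩⟩
      · exact ⟨0, fun h' => absurd h' h⟩
    choose σ hσ using this
    exact ⟨σ, hσ⟩
  obtain ⟨σ, hσ⟩ := hσ
  set S : Set (List L) := {w | Red R w ∧ W wt w = z} with hS
  have h1 : Jf wt R ρ z ≤ Jf wt R ρ (z - 1) ⊔ Submodule.span F (σ '' S) := by
    refine Submodule.span_le.2 ?_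
    rintro _ ⟨a, x, y, b, h, hz, rfl⟩
    rcases lt_or_eq_of_le hz with hz | hz
    · exact Submodule.mem_sup_left (Submodule.subset_span ⟨a, x, y, b, h, by linarith, rfl⟩)
    · have hr : Red R (a ++ x :: y :: b) := ⟨a, x, y, b, h, rfl⟩
      obtain ⟨a', x', y', b', h', e, hs⟩ := hσ _ hr
      have k := two_decomp H1 H2 h h' e
      rw [← hs, hz] at k
      have k2 : σ (a ++ x :: y :: b) ∈ Submodule.span F (σ '' S) :=
        Submodule.subset_span ⟨_, ⟨hr, by simp only [W_append, W_cons]; linarith⟩, rfl⟩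
      have := (Jf wt R ρ (z - 1) ⊔ Submodule.span F (σ '' S)).add_mem
        (Submodule.mem_sup_left k) (Submodule.mem_sup_right k2)
      simpa using this
  obtain ⟨j, hj, s, hs, rfl⟩ := Submodule.mem_sup.1 (h1 ht)
  obtain ⟨c, hc, rfl⟩ := (Finsupp.mem_span_image_iff_linearCombination F).1 hs
  have hc' : ∀ w ∈ c.support, w ∈ S := fun w hw => (Finsupp.mem_supported F c).1 hc hw
  have hTf0 : ∀ w ∈ S, ∀ f : FreeAlgebra F L →ₗ[F] F,
      (∀ w', f (word F w') = if w' = w then 1 else 0) → ∀ u ∈ Tf F wt (z - 1), f u = 0 := by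
    intro w hw f hf u hu
    have : Tf F wt (z - 1) ≤ LinearMap.ker f := by
      refine Submodule.span_le.2 ?_
      rintro _ ⟨w', hw', rfl⟩
      simp only [SetLike.mem_coe, LinearMap.mem_ker, hf]
      rw [if_neg]
      rintro rfl
      linarith [hw.2]
    exact this hu
  have hc0 : c = 0 := by
    ext w
    by_contra hne
    have hw : w ∈ S := hc' w (by simpa using hne)
    obtain ⟨f, hf⟩ := exists_coord (F := F) w
    have f1 : f (j + Finsupp.linearCombination F σ c) = 0 := by
      have : Submodule.span F (word F '' {w | w.IsChain (fun x y => ¬ R x y)})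
          ≤ LinearMap.ker f := by
        refine Submodule.span_le.2 ?_
        rintro _ ⟨w', hw', rfl⟩
        simp only [SetLike.mem_coe, LinearMap.mem_ker, hf]
        rw [if_neg]
        rintro rfl
        exact not_red hw' hw.1
      exact this hB
    have f2 : f j = 0 := hTf0 w hw f hf j (Jf_le_Tf H1 _ hj)
    have f3 : f (Finsupp.linearCombination F σ c) = c w := by
      rw [Finsupp.linearCombination_apply, Finsupp.sum, map_sum]
      have : ∀ w' ∈ c.support, f (c w' • σ w') = if w' = w then c w' else 0 := by
        intro w' hw'
        obtain ⟨a, x, y, b, h, e, hs⟩ := hσ w' (hc' w' hw').1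
        have k := lead H1 (a := a) (b := b) h
        rw [← hs, ← e] at k
        have k' : W wt a + wt x + wt y + W wt b = z := by
          rw [← (hc' w' hw').2, e]; simp only [W_append, W_cons]; ring
        rw [k'] at k
        have k0 := hTf0 w hw f hf _ k
        rw [map_sub, hf, sub_eq_zero] at k0
        rw [map_smul, k0]; simp
      rw [Finset.sum_congr rfl this, Finset.sum_ite_eq']
      rw [if_pos (by simpa using hne)]
    rw [map_add, f2, f3, zero_add] at f1
    exact hne f1
  rw [hc0]
  simpa using hj

include h0 H1 H2 in
theorem dia_ind {z : ℤ} {t : FreeAlgebra F L} (ht : t ∈ Jf wt R ρ z)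
    (hB : t ∈ Submodule.span F (word F '' {w | w.IsChain (fun x y => ¬ R x y)})) :
    t = 0 := by
  have : ∀ n : ℕ, t ∈ Jf wt R ρ (z - n) := by
    intro n
    induction n with
    | zero => simpa using ht
    | succ n ih =>
      have := descend H1 H2 ih hB
      convert this using 2
      push_cast; ring
  have h := this (z.toNat + 1)
  rw [Jf_neg h0 (by push_cast; have := Int.self_le_toNat z; linarith)] at h
  simpa using h

include h0 H1 in
theorem dia_span (z : ℤ) : Tf F wt z ≤
    Jf wt R ρ z ⊔ Submodule.span F (word F '' {w | w.IsChain (fun x y => ¬ R x y)}) := by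
  have key : ∀ n : ℕ, ∀ z : ℤ, z < n → Tf F wt z ≤
    Jf wt R ρ z ⊔ Submodule.span F (word F '' {w | w.IsChain (fun x y => ¬ R x y)}) := by
    intro n
    induction n with
    | zero =>
      intro z hz
      refine Submodule.span_le.2 ?_
      rintro _ ⟨w, hw, rfl⟩
      have := W_nonneg h0 w
      push_cast at hz
      linarith
    | succ n ih =>
      intro z hz
      push_cast at hz
      refine Submodule.span_le.2 ?_
      rintro _ ⟨w, hw, rfl⟩
      rcases red_or (R := R) w with ⟨a, x, y, b, h, rfl⟩ | h
      · have k := lead H1 (a := a) (b := b) h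
        simp only [W_append, W_cons] at hw
        have k1 := ih (z - 1) (by linarith) (Tf_mono (by linarith) k)
        have k2 := sup_le_sup_right (Jf_mono (wt := wt) (R := R) (ρ := ρ)
          (show z - 1 ≤ z by linarith)) _ k1
        have k3 : word F a * ρ x y * word F b ∈ Jf wt R ρ z :=
          Submodule.subset_span ⟨a, x, y, b, h, by linarith, rfl⟩
        have := sub_mem (Submodule.mem_sup_left k3) k2
        simpa using this
      · exact Submodule.mem_sup_right (Submodule.subset_span ⟨w, h, rfl⟩)
  exact key (z.toNat + 1) z (by push_cast; have := Int.self_le_toNat z; linarith)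

end dia

end GLGDia

namespace GLGSyz

open GLGDia PowerSeries

/-- weight function -/
def Fw (a k : ℤ) : ℤ := k * (2 * a + 1 - k)

lemma Fw_add (a b i j : ℤ) : Fw a (i + j) = Fw a i + Fw b j + 2 * (j * (a - b - i)) := by
  unfold Fw; ring

lemma coeff_mul_trunc {A : Type} [Ring A] (f g : PowerSeries A) (m n : ℕ) (hmn : m ≤ n)
    (h : ∀ i, m < i → i ≤ n → coeff i f = 0) :
    coeff n (f * g) = ∑ i ∈ Finset.range m, coeff i f * coeff (n - i) g
      + coeff m f * coeff (n - m) g := by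
  rw [coeff_mul, Finset.Nat.sum_antidiagonal_eq_sum_range_succ_mk, ← Finset.sum_range_succ]
  symm
  apply Finset.sum_subset
  · intro i; simp only [Finset.mem_range]; omega
  · intro i hi hi'
    simp only [Finset.mem_range] at hi hi'
    rw [h i (by omega) (by omega), zero_mul]

/-- letters -/
abbrev Let {V : Type} (star : V) (rk : V → ℕ) : Type :=
  {p : V × ℕ // p.1 ≠ star ∧ 1 ≤ p.2 ∧ p.2 ≤ rk p.1}

section

variable (F : Type) [Field F] {V : Type} (star : V) (rk : V → ℕ)

open Classical in
/-- coefficients -/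
noncomputable def ec (v : V) (k : ℕ) : FreeAlgebra F (Let star rk) :=
  if k = 0 then 1 else
    if h : v ≠ star ∧ 1 ≤ k ∧ k ≤ rk v then FreeAlgebra.ι F ⟨(v, k), h⟩ else 0

/-- vertex series -/
noncomputable def P (v : V) : PowerSeries (FreeAlgebra F (Let star rk)) := PowerSeries.mk (ec F star rk v)

/-- quotient series, truncated -/
noncomputable def q (v w : V) : PowerSeries (FreeAlgebra F (Let star rk)) :=
  PowerSeries.mk fun n => if n ≤ rk v - rk w then
    coeff n (P F star rk v * invOfUnit (P F star rk w) 1) else 0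

/-- defect -/
noncomputable def G (v w : V) : PowerSeries (FreeAlgebra F (Let star rk)) :=
  q F star rk v w * P F star rk w - P F star rk v

/-- relation -/
noncomputable def rho (x y : Let star rk) : FreeAlgebra F (Let star rk) :=
  coeff (x.1.2 + y.1.2) (G F star rk x.1.1 y.1.1)

/-- leading pairs -/
def Rr (Rc : V → V → Prop) (x y : Let star rk) : Prop :=
  Rc x.1.1 y.1.1 ∧ x.1.2 = rk x.1.1 - rk y.1.1

/-- weight -/
def wtL (x : Let star rk) : ℤ := Fw (rk x.1.1) x.1.2 + 1

lemma wtL_nonneg (x : Let star rk) : 0 ≤ wtL star rk x := by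
  obtain ⟨⟨v, k⟩, h1, h2, h3⟩ := x
  simp only [wtL, Fw]
  simp only at h2 h3
  have h2' : (1 : ℤ) ≤ k := by exact_mod_cast h2
  have h3' : (k : ℤ) ≤ rk v := by exact_mod_cast h3
  have : 0 ≤ (k : ℤ) * (2 * rk v + 1 - k) := mul_nonneg (by linarith) (by linarith)
  linarith

lemma ec_zero (v : V) : ec F star rk v 0 = 1 := by simp [ec]

lemma ec_big (v : V) {k : ℕ} (h : rk v < k) : ec F star rk v k = 0 := by
  unfold ec
  rw [if_neg (by omega), dif_neg]
  rintro ⟨_, _, h'⟩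
  omega

lemma ec_letter (x : Let star rk) : ec F star rk x.1.1 x.1.2 = FreeAlgebra.ι F x := by
  unfold ec
  rw [if_neg (by have := x.2.2.1; omega), dif_pos x.2]

lemma coeff_P (v : V) (n : ℕ) : coeff n (P F star rk v) = ec F star rk v n := by
  simp [P]

lemma P_const (v : V) : constantCoeff (P F star rk v) = ((1 : (FreeAlgebra F (Let star rk))ˣ) : FreeAlgebra F (Let star rk)) := by
  rw [← coeff_zero_eq_constantCoeff_apply, coeff_P, ec_zero]; rfl

lemma ec_mem (v : V) (k : ℕ) : ec F star rk v k ∈ Tf F (wtL star rk) (Fw (rk v) k + 1) := by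
  by_cases hk : k = 0
  · subst hk
    rw [ec_zero]
    exact one_mem_Tf (by simp [Fw])
  · unfold ec
    rw [if_neg hk]
    split_ifs with h
    · exact ι_mem le_rfl
    · exact zero_mem _

lemma q_zero (v w : V) {n : ℕ} (h : rk v - rk w < n) : coeff n (q F star rk v w) = 0 := by
  simp only [q, coeff_mk]
  rw [if_neg (by omega)]

lemma q_mul (v w : V) {n : ℕ} (h : n ≤ rk v - rk w) :
    coeff n (q F star rk v w * P F star rk w) = ec F star rk v n := by
  have e : P F star rk v = (P F star rk v * invOfUnit (P F star rk w) 1) * P F star rk w := by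
    rw [mul_assoc, invOfUnit_mul _ _ (P_const F star rk w), mul_one]
  rw [← coeff_P]
  conv_rhs => rw [e]
  rw [coeff_mul, coeff_mul]
  apply Finset.sum_congr rfl
  intro p hp
  have := Finset.HasAntidiagonal.mem_antidiagonal.1 hp
  congr 1
  simp only [q, coeff_mk]
  rw [if_pos (by omega)]

lemma G_low (v w : V) {n : ℕ} (h : n ≤ rk v - rk w) : coeff n (G F star rk v w) = 0 := by
  rw [G, map_sub, q_mul F star rk v w h, coeff_P, sub_self]

lemma G_high (v w : V) (hvw : rk w ≤ rk v) {n : ℕ} (h : rk v < n) :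
    coeff n (G F star rk v w) = 0 := by
  rw [G, map_sub, coeff_P, ec_big F star rk v h, sub_zero, coeff_mul]
  apply Finset.sum_eq_zero
  intro p hp
  rw [Finset.HasAntidiagonal.mem_antidiagonal] at hp
  by_cases h1 : rk v - rk w < p.1
  · rw [q_zero F star rk v w h1, zero_mul]
  · rw [coeff_P, ec_big F star rk w (by omega), mul_zero]

lemma q_coeff_zero (v w : V) : coeff 0 (q F star rk v w) = 1 := by
  have := q_mul F star rk v w (Nat.zero_le _)
  rw [coeff_mul_trunc _ _ 0 0 le_rfl (by intros; omega)] at this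
  simpa [coeff_P, ec_zero, -coeff_zero_eq_constantCoeff] using this

lemma q_mem (v w : V) (hvw : rk w < rk v) (n : ℕ) (hn : n ≤ rk v - rk w) :
    coeff n (q F star rk v w) ∈ Tf F (wtL star rk) (Fw (rk v) n + 1) ∧
    coeff n (q F star rk v w) - ec F star rk v n ∈ Tf F (wtL star rk) (Fw (rk v) n) := by
  induction n using Nat.strong_induction_on with
  | _ n ih =>
    have e := q_mul F star rk v w hn
    rw [coeff_mul_trunc _ _ n n le_rfl (by intros; omega)] at e
    simp only [Nat.sub_self, coeff_P, ec_zero, mul_one] at e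
    have k : ∑ i ∈ Finset.range n, coeff i (q F star rk v w) * ec F star rk w (n - i)
        ∈ Tf F (wtL star rk) (Fw (rk v) n) := by
      apply sum_mem
      intro i hi
      rw [Finset.mem_range] at hi
      refine Tf_mul (ih i hi (by omega)).1 (ec_mem F star rk w (n - i)) ?_
      obtain ⟨j, rfl⟩ : ∃ j, n = i + (j + 1) := ⟨n - i - 1, by omega⟩
      obtain ⟨d, hd⟩ : ∃ d, rk v = rk w + i + (j + 1) + d := ⟨rk v - rk w - i - (j + 1), by omega⟩
      rw [show i + (j + 1) - i = j + 1 by omega]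
      have := Fw_add (rk v) (rk w) i ((j + 1 : ℕ) : ℤ)
      push_cast at this ⊢
      rw [this, hd]
      push_cast
      nlinarith
    have k2 : coeff n (q F star rk v w) - ec F star rk v n ∈ Tf F (wtL star rk) (Fw (rk v) n) := by
      rw [← e, sub_add_cancel_right]
      exact neg_mem k
    refine ⟨?_, k2⟩
    have := add_mem (Tf_mono (show Fw (rk v) n ≤ Fw (rk v) n + 1 by linarith) k2)
      (ec_mem F star rk v n)
    simpa using this

variable {Rc : V → V → Prop} (hs : rk star = 0) (hdec : ∀ v w, Rc v w → rk w < rk v)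
  (htrans : ∀ u v w, Rc u v → Rc v w → Rc u w)

include hs hdec in
lemma G_mem (v w : V) (hvw : Rc v w) (n : ℕ) :
    coeff n (G F star rk v w) ∈
      Jf (wtL star rk) (Rr star rk Rc) (rho F star rk) (Fw (rk v) n + 2) := by
  have hlt := hdec v w hvw
  by_cases h1 : n ≤ rk v - rk w
  · rw [G_low F star rk v w h1]; exact zero_mem _
  by_cases h2 : rk v < n
  · rw [G_high F star rk v w hlt.le h2]; exact zero_mem _
  obtain ⟨k, rfl⟩ : ∃ k, n = (rk v - rk w) + k := ⟨n - (rk v - rk w), by omega⟩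
  have hv : v ≠ star := by rintro rfl; omega
  have hw : w ≠ star := by rintro rfl; omega
  have := ρ_mem (wt := wtL star rk) (ρ := rho F star rk) (R := Rr star rk Rc)
    (x := ⟨(v, rk v - rk w), hv, by dsimp only; omega, by dsimp only; omega⟩)
    (y := ⟨(w, k), hw, by dsimp only; omega, by dsimp only; omega⟩) ⟨hvw, rfl⟩
    (z := Fw (rk v) ((rk v - rk w + k : ℕ) : ℤ) + 2) (by
      simp only [wtL]
      have := Fw_add (rk v) (rk w) ((rk v - rk w : ℕ) : ℤ) k
      push_cast [hlt.le] at this ⊢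
      rw [this]
      apply le_of_eq; ring)
  simpa [rho] using this

include hdec in
lemma H1 (x y : Let star rk) (h : Rr star rk Rc x y) :
    rho F star rk x y - FreeAlgebra.ι F x * FreeAlgebra.ι F y
      ∈ Tf F (wtL star rk) (wtL star rk x + wtL star rk y - 1) := by
  have hx := ec_letter F star rk x
  have hy := ec_letter F star rk y
  obtain ⟨⟨v, m⟩, x1, x2, x3⟩ := x
  obtain ⟨⟨w, k⟩, y1, y2, y3⟩ := y
  obtain ⟨hvw, hm⟩ := h
  simp only at hx hy x1 x2 x3 y1 y2 y3 hvw hm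
  rw [← hx, ← hy]
  have hlt := hdec v w hvw
  simp only [rho, wtL, G, map_sub]
  rw [coeff_mul_trunc _ _ m (m + k) (by omega)
    (fun i hi _ => q_zero F star rk v w (by omega))]
  simp only [coeff_P, Nat.add_sub_cancel_left]
  have hmz : (m : ℤ) = rk v - rk w := by rw [hm]; push_cast [hlt.le]; ring
  have k1 : ∑ i ∈ Finset.range m, coeff i (q F star rk v w) * ec F star rk w (m + k - i)
      ∈ Tf F (wtL star rk) (Fw (rk v) m + 1 + (Fw (rk w) k + 1) - 1) := by
    apply sum_mem
    intro i hi
    rw [Finset.mem_range] at hi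
    refine Tf_mul (q_mem F star rk v w hlt i (by omega)).1 (ec_mem F star rk w _) ?_
    have e1 := Fw_add (rk v) (rk w) m k
    have e2 := Fw_add (rk v) (rk w) i ((m + k - i : ℕ) : ℤ)
    push_cast [show i ≤ m + k by omega] at e2 ⊢
    rw [show (i : ℤ) + (m + k - i) = m + k by ring] at e2
    have i1 : (1 : ℤ) ≤ m - i := by have : (i : ℤ) < m := by exact_mod_cast hi
                                    linarith
    have i2 : (1 : ℤ) ≤ m + k - i := by linarith [Int.natCast_nonneg k]
    have : (1 : ℤ) ≤ (m + k - i) * (rk v - rk w - i) := by rw [← hmz]; nlinarith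
    have : (k : ℤ) * (rk v - rk w - m) = 0 := by rw [hmz]; ring
    linarith
  have k2 := Tf_mul (q_mem F star rk v w hlt m (by omega)).2 (ec_mem F star rk w k)
    (u := (Fw (rk v) m + 1 + (Fw (rk w) k + 1) - 1)) (by linarith)
  have k3 := Tf_mono (y := Fw (rk v) ((m + k : ℕ) : ℤ) + 1)
    (z := (Fw (rk v) m + 1 + (Fw (rk w) k + 1) - 1)) (by
      have e1 := Fw_add (rk v) (rk w) m k
      push_cast
      have : (k : ℤ) * (rk v - rk w - m) = 0 := by rw [hmz]; ring
      linarith) (ec_mem F star rk v (m + k))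
  convert sub_mem (add_mem k1 k2) k3 using 1
  noncomm_ring

section three

variable (v w u : V)

/-- difference -/
noncomputable def hh : PowerSeries (FreeAlgebra F (Let star rk)) :=
  q F star rk v u - q F star rk v w * q F star rk w u

lemma G_ident : G F star rk v u = q F star rk v w * G F star rk w u + G F star rk v w
    + hh F star rk v w u * P F star rk u := by
  unfold G hh; noncomm_ring

lemma hh_zero (h1 : rk w < rk v) (h2 : rk u < rk w) {n : ℕ} (hn : rk v - rk u < n) :
    coeff n (hh F star rk v w u) = 0 := by
  rw [hh, map_sub, q_zero F star rk v u hn, zero_sub, neg_eq_zero, coeff_mul]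
  apply Finset.sum_eq_zero
  intro p hp
  rw [Finset.HasAntidiagonal.mem_antidiagonal] at hp
  by_cases h : rk v - rk w < p.1
  · rw [q_zero F star rk v w h, zero_mul]
  · rw [q_zero F star rk w u (by omega), mul_zero]

variable {v w u}

include hs hdec in
lemma S_term (h1 : Rc v w) (h2 : Rc w u) {i j : ℕ} (hi : i < rk v - rk w) :
    coeff i (q F star rk v w) * coeff j (G F star rk w u) ∈
      Jf (wtL star rk) (Rr star rk Rc) (rho F star rk) (Fw (rk v) ((i + j : ℕ) : ℤ) + 1) := by
  have d1 := hdec _ _ h1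
  have d2 := hdec _ _ h2
  by_cases hj : j ≤ rk w - rk u
  · rw [G_low F star rk w u hj, mul_zero]; exact zero_mem _
  refine Tf_mul_Jf (q_mem F star rk v w d1 i (by omega)).1 (G_mem F star rk hs hdec w u h2 j) ?_
  have e := Fw_add (rk v) (rk w) i j
  have i1 : (1 : ℤ) ≤ j := by omega
  have i2 : (1 : ℤ) ≤ rk v - rk w - i := by omega
  have : (1 : ℤ) ≤ j * (rk v - rk w - i) := by nlinarith
  push_cast
  linarith

include hs hdec in
lemma S_mem (h1 : Rc v w) (h2 : Rc w u) {n : ℕ} (hn : n ≤ rk v - rk u) :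
    coeff n (q F star rk v w * G F star rk w u) ∈
      Jf (wtL star rk) (Rr star rk Rc) (rho F star rk) (Fw (rk v) n + 1) := by
  have d1 := hdec _ _ h1
  have d2 := hdec _ _ h2
  rw [coeff_mul]
  apply sum_mem
  intro p hp
  rw [Finset.HasAntidiagonal.mem_antidiagonal] at hp
  by_cases hp1 : p.1 < rk v - rk w
  · rw [← hp]; exact S_term F star rk hs hdec h1 h2 hp1
  · rw [G_low F star rk w u (by omega), mul_zero]; exact zero_mem _

lemma hh_term {i j : ℕ} (hi : i < rk v - rk u) (hj : 1 ≤ j)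
    (h : coeff i (hh F star rk v w u) ∈
      Jf (wtL star rk) (Rr star rk Rc) (rho F star rk) (Fw (rk v) i + 2)) :
    coeff i (hh F star rk v w u) * ec F star rk u j ∈
      Jf (wtL star rk) (Rr star rk Rc) (rho F star rk) (Fw (rk v) ((i + j : ℕ) : ℤ) + 1) := by
  refine Jf_mul_Tf h (ec_mem F star rk u j) ?_
  have e := Fw_add (rk v) (rk u) i j
  have i1 : (1 : ℤ) ≤ j := by omega
  have i2 : (1 : ℤ) ≤ rk v - rk u - i := by omega
  have : (1 : ℤ) ≤ j * (rk v - rk u - i) := by nlinarith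
  push_cast
  linarith

include hs hdec in
lemma hh_mem (h1 : Rc v w) (h2 : Rc w u) (n : ℕ) (hn : n ≤ rk v - rk u) :
    coeff n (hh F star rk v w u) ∈
      Jf (wtL star rk) (Rr star rk Rc) (rho F star rk) (Fw (rk v) n + 2) ∧
    coeff n (hh F star rk v w u) + coeff n (G F star rk v w) ∈
      Jf (wtL star rk) (Rr star rk Rc) (rho F star rk) (Fw (rk v) n + 1) := by
  induction n using Nat.strong_induction_on with
  | _ n ih =>
    have e := congrArg (coeff n) (G_ident F star rk v w u)
    rw [G_low F star rk v u hn, map_add, map_add,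
      coeff_mul_trunc (hh F star rk v w u) _ n n le_rfl (by intros; omega)] at e
    simp only [Nat.sub_self, coeff_P, ec_zero, mul_one] at e
    have k : ∑ i ∈ Finset.range n, coeff i (hh F star rk v w u) * ec F star rk u (n - i)
        ∈ Jf (wtL star rk) (Rr star rk Rc) (rho F star rk) (Fw (rk v) n + 1) := by
      apply sum_mem
      intro i hi
      rw [Finset.mem_range] at hi
      have := hh_term F star rk (i := i) (j := n - i) (by omega) (by omega)
        (ih i hi (by omega)).1
      rwa [show i + (n - i) = n by omega] at this
    have k2 : coeff n (hh F star rk v w u) + coeff n (G F star rk v w) ∈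
        Jf (wtL star rk) (Rr star rk Rc) (rho F star rk) (Fw (rk v) n + 1) := by
      have := neg_mem (add_mem (S_mem F star rk hs hdec h1 h2 hn) k)
      convert this using 1
      rw [← sub_eq_zero]
      refine Eq.trans ?_ e.symm
      abel
    refine ⟨?_, k2⟩
    have := sub_mem (Jf_mono (show Fw (rk v) n + 1 ≤ Fw (rk v) n + 2 by linarith) k2)
      (G_mem F star rk hs hdec v w h1 n)
    simpa using this

end three

include hs hdec htrans in
lemma H2 (x y z : Let star rk) (hxy : Rr star rk Rc x y) (hyz : Rr star rk Rc y z) :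
    rho F star rk x y * FreeAlgebra.ι F z - FreeAlgebra.ι F x * rho F star rk y z
      ∈ Jf (wtL star rk) (Rr star rk Rc) (rho F star rk)
        (wtL star rk x + wtL star rk y + wtL star rk z - 1) := by
  have hx := ec_letter F star rk x
  have hz := ec_letter F star rk z
  obtain ⟨⟨v, m⟩, x1, x2, x3⟩ := x
  obtain ⟨⟨w, m'⟩, y1, y2, y3⟩ := y
  obtain ⟨⟨u, k⟩, z1, z2, z3⟩ := z
  obtain ⟨hvw, hm⟩ := hxy
  obtain ⟨hwu, hm'⟩ := hyz
  simp only at hx hz x1 x2 x3 y1 y2 y3 z1 z2 z3 hvw hm hwu hm'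
  rw [← hx, ← hz]
  have d1 := hdec v w hvw
  have d2 := hdec w u hwu
  simp only [rho, wtL]
  have hM : rk v - rk u = m + m' := by omega
  have hmz : (m : ℤ) = rk v - rk w := by omega
  have hmz' : (m' : ℤ) = rk w - rk u := by omega
  have E1 := Fw_add (rk v) (rk u) ((m : ℤ) + m') k
  have E2 := Fw_add (rk v) (rk w) m m'
  have E3 := Fw_add (rk v) (rk w) m (m' + k)
  rw [show (k : ℤ) * (rk v - rk u - (m + m')) = 0 by rw [hmz, hmz']; ring] at E1
  rw [show (m' : ℤ) * (rk v - rk w - m) = 0 by rw [hmz]; ring] at E2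
  rw [show ((m' : ℤ) + k) * (rk v - rk w - m) = 0 by rw [hmz]; ring, ← add_assoc] at E3
  set T : ℤ := Fw (rk v) m + 1 + (Fw (rk w) m' + 1) + (Fw (rk u) k + 1) - 1 with hT
  have TE : T = Fw (rk v) ((m + m' + k : ℕ) : ℤ) + 2 := by push_cast; rw [hT]; linarith
  have e := congrArg (coeff (m + m' + k)) (G_ident F star rk v w u)
  rw [map_add, map_add,
    coeff_mul_trunc (hh F star rk v w u) _ (m + m') (m + m' + k) (by omega)
      (fun i hi _ => hh_zero F star rk v w u d1 d2 (by omega)),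
    coeff_mul_trunc (q F star rk v w) _ m (m + m' + k) (by omega)
      (fun i hi _ => q_zero F star rk v w (by omega))] at e
  simp only [Nat.add_sub_cancel_left, coeff_P, show m + m' + k - m = m' + k by omega] at e
  have t1 : coeff (m + m' + k) (G F star rk v u) ∈
      Jf (wtL star rk) (Rr star rk Rc) (rho F star rk) T := by
    rw [TE]; exact G_mem F star rk hs hdec v u (htrans _ _ _ hvw hwu) _
  have t2 : coeff (m + m' + k) (G F star rk v w) ∈
      Jf (wtL star rk) (Rr star rk Rc) (rho F star rk) T := by
    rw [TE]; exact G_mem F star rk hs hdec v w hvw _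
  have t3 : ∑ i ∈ Finset.range m, coeff i (q F star rk v w) *
      coeff (m + m' + k - i) (G F star rk w u) ∈
      Jf (wtL star rk) (Rr star rk Rc) (rho F star rk) T := by
    apply sum_mem
    intro i hi
    rw [Finset.mem_range] at hi
    have := S_term F star rk hs hdec hvw hwu (i := i) (j := m + m' + k - i) (by omega)
    rw [show i + (m + m' + k - i) = m + m' + k by omega] at this
    exact Jf_mono (by linarith) this
  have t4 : ∑ i ∈ Finset.range (m + m'), coeff i (hh F star rk v w u) *
      ec F star rk u (m + m' + k - i) ∈
      Jf (wtL star rk) (Rr star rk Rc) (rho F star rk) T := by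
    apply sum_mem
    intro i hi
    rw [Finset.mem_range] at hi
    have := hh_term F star rk (i := i) (j := m + m' + k - i) (by omega) (by omega)
      (hh_mem F star rk hs hdec hvw hwu i (by omega)).1
    rw [show i + (m + m' + k - i) = m + m' + k by omega] at this
    exact Jf_mono (by linarith) this
  have t5 := Tf_mul_Jf (q_mem F star rk v w d1 m (by omega)).2
    (G_mem F star rk hs hdec w u hwu (m' + k)) (u := T) (by push_cast at TE ⊢; linarith)
  have t6 := Jf_mul_Tf (hh_mem F star rk hs hdec hvw hwu (m + m') (by omega)).2
    (ec_mem F star rk u k) (u := T) (by push_cast at TE ⊢; linarith)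
  have := add_mem (sub_mem (add_mem (add_mem (add_mem t2 t3) t4) t5) t1) t6
  convert this using 1
  rw [e]
  noncomm_ring

end

end GLGSyz

namespace GLGMain

open GLGDia GLGSyz PowerSeries GLG

lemma cancel_trunc {A : Type} [Ring A] (f g p : PowerSeries A) (hp : constantCoeff p = 1) (m : ℕ)
    (h : ∀ n ≤ m, coeff n (f * p) = coeff n (g * p)) (n : ℕ) (hn : n ≤ m) :
    coeff n f = coeff n g := by
  have key : ∀ f : PowerSeries A, f = (f * p) * invOfUnit p 1 := by
    intro f
    rw [mul_assoc, mul_invOfUnit _ _ (by rw [hp]; rfl), mul_one]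
  rw [key f, key g, coeff_mul, coeff_mul]
  apply Finset.sum_congr rfl
  rintro ⟨i, j⟩ hij
  rw [Finset.HasAntidiagonal.mem_antidiagonal] at hij
  simp only at hij ⊢
  rw [h i (by omega)]

lemma cancel {A : Type} [Ring A] (f g p : PowerSeries A) (hp : constantCoeff p = 1)
    (h : f * p = g * p) : f = g := by
  ext n
  exact cancel_trunc f g p hp n (fun i _ => by rw [h]) n le_rfl

section

variable (F : Type) [Field F] {V E : Type} (tl hd : E → V) (rk : V → ℕ)

/-- path series -/
noncomputable def UP (es : List E) : PowerSeries (FreeAlgebra F (ESharp tl hd rk)) :=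
  PowerSeries.mk (eP F tl hd rk es)

/-- edge series -/
noncomputable def UE (e : E) : PowerSeries (FreeAlgebra F (ESharp tl hd rk)) :=
  PowerSeries.mk fun j => (-1 : FreeAlgebra F (ESharp tl hd rk)) ^ j * (Pe F tl hd rk e).coeff j

lemma coeff_UP (es : List E) (n : ℕ) : coeff n (UP F tl hd rk es) = eP F tl hd rk es n := by
  simp [UP]

lemma UP_nil : UP F tl hd rk [] = 1 := by
  ext n
  rw [coeff_UP, coeff_one]
  simp only [eP, List.map_nil, List.prod_nil, Polynomial.coeff_one]
  by_cases h : n = 0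
  · simp [h]
  · simp [h]

lemma UP_cons (e : E) (es : List E) :
    UP F tl hd rk (e :: es) = UE F tl hd rk e * UP F tl hd rk es := by
  ext n
  rw [coeff_UP, coeff_mul]
  simp only [eP, List.map_cons, List.prod_cons, Polynomial.coeff_mul, Finset.mul_sum, UE, UP,
    coeff_mk]
  apply Finset.sum_congr rfl
  rintro ⟨i, j⟩ hij
  rw [Finset.HasAntidiagonal.mem_antidiagonal] at hij
  simp only at hij ⊢
  rw [← hij, pow_add]
  have : Commute ((-1 : FreeAlgebra F (ESharp tl hd rk)) ^ j) ((Pe F tl hd rk e).coeff i) :=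
    (Commute.neg_one_left _).pow_left j
  rw [mul_assoc, ← mul_assoc _ ((Pe F tl hd rk e).coeff i), this.eq]
  simp only [mul_assoc]

lemma UE_zero (e : E) : coeff 0 (UE F tl hd rk e) = 1 := by
  simp only [UE, coeff_mk, Pe, Polynomial.coeff_add, Polynomial.finset_sum_coeff,
    Polynomial.coeff_C_mul_X_pow, pow_zero, one_mul, Polynomial.coeff_one_zero]
  rw [Finset.sum_eq_zero, add_zero]
  rintro ⟨j, hj⟩ _
  rw [Finset.mem_Icc] at hj
  rw [if_neg (by simp only; omega)]

lemma UE_big (e : E) {n : ℕ} (h : len tl hd rk e < n) : coeff n (UE F tl hd rk e) = 0 := by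
  simp only [UE, coeff_mk, Pe, Polynomial.coeff_add, Polynomial.finset_sum_coeff,
    Polynomial.coeff_C_mul_X_pow, Polynomial.coeff_one]
  rw [Finset.sum_eq_zero, add_zero, if_neg (by omega), mul_zero]
  rintro ⟨j, hj⟩ _
  rw [Finset.mem_Icc] at hj
  rw [if_neg (by simp only; omega)]

lemma UE_mid (s : ESharp tl hd rk) : coeff s.2.1 (UE F tl hd rk s.1) = FreeAlgebra.ι F s := by
  obtain ⟨e, j, h1, h2⟩ := s
  simp only [UE, coeff_mk, Pe, Polynomial.coeff_add, Polynomial.finset_sum_coeff,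
    Polynomial.coeff_C_mul_X_pow, Polynomial.coeff_one]
  rw [if_neg (by omega), zero_add, Finset.sum_eq_single ⟨j, Finset.mem_Icc.2 ⟨h1, h2⟩⟩]
  · rw [if_pos rfl, ← mul_assoc, ← pow_add, ← two_mul, pow_mul]; simp
  · rintro ⟨i, hi⟩ _ hne
    rw [if_neg]
    rintro rfl
    exact hne rfl
  · intro h; exact absurd (Finset.mem_attach _ _) h

lemma UP_zero (es : List E) : coeff 0 (UP F tl hd rk es) = 1 := by
  induction es with
  | nil => rw [UP_nil]; simp
  | cons e es ih =>
    rw [UP_cons, coeff_mul]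
    simp only [Finset.Nat.antidiagonal_zero, Finset.sum_singleton, ih, UE_zero, mul_one]

variable {tl hd rk}

lemma path_cons {e a : E} {es : List E} :
    IsPathC tl hd e (a :: es) ↔ hd e = tl a ∧ IsPathC tl hd a es := by
  unfold IsPathC
  exact List.isChain_cons_cons

lemma path_nil (e : E) : IsPathC tl hd e [] := by
  unfold IsPathC
  exact List.isChain_singleton _

lemma dst_cons {e a : E} {es : List E} : pathDst hd e (a :: es) = pathDst hd a es := by
  simp [pathDst]

lemma dst_nil {e : E} : pathDst hd e [] = hd e := by
  simp [pathDst]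

lemma reaches_edge (e : E) : Reaches tl hd (tl e) (hd e) :=
  ⟨e, [], path_nil e, rfl, dst_nil⟩

lemma reaches_cons {e : E} {u : V} (h : Reaches tl hd (hd e) u) : Reaches tl hd (tl e) u := by
  obtain ⟨a, es, h1, h2, h3⟩ := h
  exact ⟨e, a :: es, path_cons.2 ⟨h2.symm, h1⟩, rfl, by rw [dst_cons, h3]⟩

lemma reaches_trans {u v w : V} (h1 : Reaches tl hd u v) (h2 : Reaches tl hd v w) :
    Reaches tl hd u w := by
  obtain ⟨e, es, hp, rfl, rfl⟩ := h1
  induction es generalizing e with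
  | nil => rw [dst_nil] at h2; exact reaches_cons h2
  | cons a es ih =>
    rw [path_cons] at hp
    rw [dst_cons] at h2
    have := ih a hp.2 h2
    rw [← hp.1] at this
    exact reaches_cons this

lemma path_dec (hr : IsRank tl hd rk) {e : E} {es : List E} (hp : IsPathC tl hd e es) :
    rk (pathDst hd e es) < rk (tl e) := by
  induction es generalizing e with
  | nil => rw [dst_nil]; exact hr e
  | cons a es ih =>
    rw [path_cons] at hp
    rw [dst_cons]
    have := ih hp.2
    have h2 := hr e
    rw [hp.1] at h2
    omega

lemma reaches_dec (hr : IsRank tl hd rk) (v w : V) (h : Reaches tl hd v w) : rk w < rk v := by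
  obtain ⟨e, es, hp, rfl, rfl⟩ := h
  exact path_dec hr hp

lemma UP_big (hr : IsRank tl hd rk) {e : E} {es : List E} (hp : IsPathC tl hd e es) {n : ℕ}
    (hn : rk (tl e) - rk (pathDst hd e es) < n) : coeff n (UP F tl hd rk (e :: es)) = 0 := by
  induction es generalizing e n with
  | nil =>
    rw [UP_cons, UP_nil, mul_one]
    rw [dst_nil] at hn
    exact UE_big F tl hd rk e hn
  | cons a es ih =>
    rw [path_cons] at hp
    rw [dst_cons] at hn
    have h2 := hr e
    have h3 := path_dec hr hp.2
    rw [UP_cons, coeff_mul]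
    apply Finset.sum_eq_zero
    rintro ⟨i, j⟩ hij
    rw [Finset.HasAntidiagonal.mem_antidiagonal] at hij
    simp only at hij ⊢
    by_cases hi : len tl hd rk e < i
    · rw [UE_big F tl hd rk e hi, zero_mul]
    · rw [ih hp.2, mul_zero]
      unfold len at hi
      rw [hp.1] at h2 hi
      omega

lemma path_mul {A : Type} [Ring A] (f : FreeAlgebra F (ESharp tl hd rk) →+* A)
    (Pv : V → PowerSeries A)
    (hE : ∀ e, PowerSeries.map f (UE F tl hd rk e) * Pv (hd e) = Pv (tl e))
    {e : E} {es : List E} (hp : IsPathC tl hd e es) :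
    PowerSeries.map f (UP F tl hd rk (e :: es)) * Pv (pathDst hd e es) = Pv (tl e) := by
  induction es generalizing e with
  | nil => rw [UP_cons, UP_nil, mul_one, dst_nil, hE]
  | cons a es ih =>
    rw [path_cons] at hp
    rw [UP_cons, map_mul, mul_assoc, dst_cons, ih hp.2, ← hp.1, hE]

lemma pA_eq (hr : IsRank tl hd rk) {e1 e2 : E} {es1 es2 : List E} (h1 : IsPathC tl hd e1 es1)
    (h2 : IsPathC tl hd e2 es2) (ht : tl e1 = tl e2)
    (hd' : pathDst hd e1 es1 = pathDst hd e2 es2) (n : ℕ) :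
    mkA F tl hd rk (coeff n (UP F tl hd rk (e1 :: es1))) =
      mkA F tl hd rk (coeff n (UP F tl hd rk (e2 :: es2))) := by
  by_cases h0 : n = 0
  · subst h0
    rw [UP_zero, UP_zero]
  by_cases hn : n ≤ rk (tl e1) - rk (pathDst hd e1 es1)
  · rw [coeff_UP, coeff_UP]
    exact RingQuot.mkAlgHom_rel F ⟨e1, es1, e2, es2, n, h1, h2, ht, hd', by omega, hn, rfl, rfl⟩
  · rw [UP_big F hr h1 (by omega), UP_big F hr h2 (by rw [← ht, ← hd']; omega)]

end


section main

variable (F : Type) [Field F] {V E : Type} {tl hd : E → V} {rk : V → ℕ} (hrank : GLG.IsRank tl hd rk)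
    {star : V} (hstar0 : rk star = 0)
    (hmin : ∀ v : V, (∀ e : E, tl e ≠ v) ↔ v = star)
    {sel : V → E} (hsel : ∀ v : V, v ≠ star → tl (sel v) = v)
    {pathOf : V → List E}
    (hpathOf0 : pathOf star = [])
    (hpathOfS : ∀ v : V, v ≠ star → pathOf v = sel v :: pathOf (hd (sel v)))

include hmin in
lemma tl_ne (e : E) : tl e ≠ star := fun h => (hmin star).2 rfl e h

include hrank hsel hpathOf0 hpathOfS in
lemma pathOf_spec (e : E) : IsPathC tl hd e (pathOf (hd e)) ∧
    pathDst hd e (pathOf (hd e)) = star := by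
  induction hn : rk (hd e) using Nat.strong_induction_on generalizing e with
  | _ n ih =>
    by_cases h : hd e = star
    · rw [h, hpathOf0]
      exact ⟨path_nil e, by rw [dst_nil, h]⟩
    · have h1 := hsel _ h
      have h2 := hrank (sel (hd e))
      rw [h1, hn] at h2
      have := ih _ h2 _ rfl
      rw [hpathOfS _ h]
      exact ⟨path_cons.2 ⟨h1.symm, this.1⟩, by rw [dst_cons, this.2]⟩

section span

variable (tl hd rk pathOf) in
/-- vertex series in the quotient -/
noncomputable def PA (v : V) : PowerSeries (AGamma F tl hd rk) :=
  PowerSeries.map (RingHomClass.toRingHom (mkA F tl hd rk)) (UP F tl hd rk (pathOf v))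

include hrank hmin hsel hpathOf0 hpathOfS in
lemma PA_edge (e : E) : PowerSeries.map (RingHomClass.toRingHom (mkA F tl hd rk)) (UE F tl hd rk e) *
    PA F tl hd rk pathOf (hd e) = PA F tl hd rk pathOf (tl e) := by
  have h := tl_ne hmin e
  unfold PA
  rw [← map_mul, ← UP_cons, hpathOfS _ h]
  ext n
  rw [coeff_map, coeff_map]
  have s1 := pathOf_spec hrank hsel hpathOf0 hpathOfS e
  have s2 := pathOf_spec hrank hsel hpathOf0 hpathOfS (sel (tl e))
  exact pA_eq F hrank s1.1 s2.1 (hsel _ h).symm (by rw [s1.2, s2.2]) n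

variable (tl hd rk pathOf star) in
/-- the map from the free algebra on letters -/
noncomputable def phi : FreeAlgebra F (Let star rk) →ₐ[F] AGamma F tl hd rk :=
  FreeAlgebra.lift F fun x => mkA F tl hd rk (eP F tl hd rk (pathOf x.1.1) x.1.2)

include hrank hstar0 hsel hpathOf0 hpathOfS in
lemma phi_P (v : V) : PowerSeries.map (RingHomClass.toRingHom (phi F tl hd rk star pathOf)) (P F star rk v) =
    PA F tl hd rk pathOf v := by
  ext n
  unfold PA
  rw [coeff_map, coeff_map, coeff_P]
  by_cases h0 : n = 0
  · subst h0
    rw [ec_zero, UP_zero, map_one, map_one]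
  by_cases hn : rk v < n
  · rw [ec_big F star rk v hn, map_zero]
    by_cases hv : v = star
    · rw [hv, hpathOf0, UP_nil, coeff_one, if_neg h0, map_zero]
    · rw [hpathOfS v hv]
      have s2 := pathOf_spec hrank hsel hpathOf0 hpathOfS (sel v)
      rw [UP_big F hrank s2.1, map_zero]
      rw [s2.2, hsel v hv]; omega
  · have hv : v ≠ star := by rintro rfl; omega
    have := ec_letter F star rk ⟨(v, n), hv, by dsimp only; omega, by dsimp only; omega⟩
    simp only at this
    rw [this, coeff_UP]
    simp [phi]

lemma PA_const (v : V) : constantCoeff (PA F tl hd rk pathOf v) = 1 := by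
  rw [← coeff_zero_eq_constantCoeff_apply]
  unfold PA
  rw [coeff_map, UP_zero, map_one]

include hrank hstar0 hmin hsel hpathOf0 hpathOfS in
lemma phi_q {e : E} {es : List E} (hp : IsPathC tl hd e es) :
    PowerSeries.map (RingHomClass.toRingHom (phi F tl hd rk star pathOf)) (q F star rk (tl e) (pathDst hd e es)) =
      PowerSeries.map (RingHomClass.toRingHom (mkA F tl hd rk)) (UP F tl hd rk (e :: es)) := by
  ext n
  by_cases hn : n ≤ rk (tl e) - rk (pathDst hd e es)
  · refine cancel_trunc _ _ (PA F tl hd rk pathOf (pathDst hd e es)) (PA_const F _) _ ?_ n hn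
    intro k hk
    rw [path_mul F _ _ (PA_edge F hrank hmin hsel hpathOf0 hpathOfS) hp,
      ← phi_P F hrank hstar0 hsel hpathOf0 hpathOfS, ← phi_P F hrank hstar0 hsel hpathOf0 hpathOfS,
      ← map_mul, coeff_map, coeff_map, q_mul F star rk _ _ hk, coeff_P]
  · rw [coeff_map, coeff_map, UP_big F hrank hp (by omega), q_zero F star rk _ _ (by omega),
      map_zero, map_zero]

include hrank hstar0 hmin hsel hpathOf0 hpathOfS in
lemma phi_rho (x y : Let star rk) (h : Rr star rk (Reaches tl hd) x y) :
    phi F tl hd rk star pathOf (rho F star rk x y) = 0 := by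
  obtain ⟨⟨e, es, hp, h1, h2⟩, -⟩ := h
  unfold rho
  rw [← h1, ← h2]
  have : PowerSeries.map (RingHomClass.toRingHom (phi F tl hd rk star pathOf))
      (G F star rk (tl e) (pathDst hd e es)) = 0 := by
    unfold G
    rw [map_sub, map_mul, phi_q F hrank hstar0 hmin hsel hpathOf0 hpathOfS hp,
      phi_P F hrank hstar0 hsel hpathOf0 hpathOfS, phi_P F hrank hstar0 hsel hpathOf0 hpathOfS,
      path_mul F _ _ (PA_edge F hrank hmin hsel hpathOf0 hpathOfS) hp, sub_self]
  have := congrArg (coeff (x.1.2 + y.1.2)) this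
  rwa [coeff_map, map_zero] at this

include hrank hstar0 hmin hsel hpathOf0 hpathOfS in
lemma phi_J (z : ℤ) : Jf (wtL star rk) (Rr star rk (Reaches tl hd)) (rho F star rk) z ≤
    LinearMap.ker (phi F tl hd rk star pathOf).toLinearMap := by
  unfold Jf
  rw [Submodule.span_le]
  rintro _ ⟨a, x, y, b, h, -, rfl⟩
  simp only [SetLike.mem_coe, LinearMap.mem_ker, AlgHom.toLinearMap_apply, map_mul]
  rw [phi_rho F hrank hstar0 hmin hsel hpathOf0 hpathOfS x y h, mul_zero, zero_mul]

include hrank hstar0 hmin hsel hpathOf0 hpathOfS in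
lemma phi_surj : Function.Surjective (phi F tl hd rk star pathOf) := by
  have key : ∀ t, mkA F tl hd rk t ∈ (phi F tl hd rk star pathOf).range := by
    intro t
    induction t using FreeAlgebra.induction with
    | grade0 r => rw [AlgHom.commutes]; exact Subalgebra.algebraMap_mem _ r
    | grade1 s =>
      refine ⟨coeff s.2.1 (q F star rk (tl s.1) (hd s.1)), ?_⟩
      have := phi_q F hrank hstar0 hmin hsel hpathOf0 hpathOfS (path_nil s.1)
      rw [dst_nil, UP_cons, UP_nil, mul_one] at this
      have := congrArg (coeff s.2.1) this
      rw [coeff_map, coeff_map, UE_mid] at this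
      exact this
    | mul a b ha hb => rw [map_mul]; exact mul_mem ha hb
    | add a b ha hb => rw [map_add]; exact add_mem ha hb
  intro a
  obtain ⟨t, rfl⟩ := RingQuot.mkAlgHom_surjective F (rel F tl hd rk) a
  exact key t

lemma phi_word (w : List (Let star rk)) : phi F tl hd rk star pathOf (word F w) =
    ((w.map Subtype.val).map fun p => mkA F tl hd rk (eP F tl hd rk (pathOf p.1) p.2)).prod := by
  induction w with
  | nil => simp [word_nil]
  | cons x w ih =>
    rw [word_cons, map_mul, ih]
    simp [phi]

include hrank hstar0 hmin hsel hpathOf0 hpathOfS in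
theorem spanning : Submodule.span F (Set.range
        (fun b : {b : List (V × ℕ) //
            (∀ p ∈ b, p.1 ≠ star ∧ 1 ≤ p.2 ∧ p.2 ≤ rk p.1) ∧
            b.Chain' (fun p q => ¬(GLG.Reaches tl hd p.1 q.1 ∧ p.2 = rk p.1 - rk q.1))} =>
          (b.1.map fun p =>
            GLG.mkA F tl hd rk (GLG.eP F tl hd rk (pathOf p.1) p.2)).prod)) = ⊤ := by
  rw [eq_top_iff]
  rintro a -
  obtain ⟨t, rfl⟩ := phi_surj F hrank hstar0 hmin hsel hpathOf0 hpathOfS a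
  obtain ⟨z, hz⟩ := exists_Tf (wtL star rk) t
  have := dia_span (wtL_nonneg star rk) (H1 F star rk (reaches_dec hrank)) z hz
  obtain ⟨u, hu, s, hs, rfl⟩ := Submodule.mem_sup.1 this
  have hu' := phi_J F hrank hstar0 hmin hsel hpathOf0 hpathOfS z hu
  simp only [LinearMap.mem_ker, AlgHom.toLinearMap_apply] at hu'
  rw [map_add, hu', zero_add]
  have : Submodule.span F (word F '' {w | w.IsChain (fun x y => ¬ Rr star rk (Reaches tl hd) x y)}) ≤
    (Submodule.span F (Set.range
        (fun b : {b : List (V × ℕ) //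
            (∀ p ∈ b, p.1 ≠ star ∧ 1 ≤ p.2 ∧ p.2 ≤ rk p.1) ∧
            b.Chain' (fun p q => ¬(GLG.Reaches tl hd p.1 q.1 ∧ p.2 = rk p.1 - rk q.1))} =>
          (b.1.map fun p =>
            GLG.mkA F tl hd rk (GLG.eP F tl hd rk (pathOf p.1) p.2)).prod))).comap
      (phi F tl hd rk star pathOf).toLinearMap := by
    rw [Submodule.span_le]
    rintro _ ⟨w, hw, rfl⟩
    simp only [Submodule.comap_coe, Set.mem_preimage, AlgHom.toLinearMap_apply, SetLike.mem_coe]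
    rw [phi_word]
    refine Submodule.subset_span ⟨⟨w.map Subtype.val, ?_, ?_⟩, rfl⟩
    · intro p hp
      obtain ⟨x, _, rfl⟩ := List.mem_map.1 hp
      exact x.2
    · exact (List.isChain_map _).2 hw
  exact this hs

end span

section indep

variable (star tl hd rk) in
/-- the ideal -/
noncomputable def JI (hrank : GLG.IsRank tl hd rk) : TwoSidedIdeal (FreeAlgebra F (Let star rk)) :=
  TwoSidedIdeal.mk' {t | ∃ z, t ∈ Jf (wtL star rk) (Rr star rk (Reaches tl hd)) (rho F star rk) z}
    ⟨0, zero_mem _⟩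
    (by
      rintro x y ⟨a, ha⟩ ⟨b, hb⟩
      exact ⟨max a b, add_mem (Jf_mono (le_max_left _ _) ha) (Jf_mono (le_max_right _ _) hb)⟩)
    (by rintro x ⟨a, ha⟩; exact ⟨a, neg_mem ha⟩)
    (by
      rintro x y ⟨a, ha⟩
      obtain ⟨b, hb⟩ := exists_Tf (wtL star rk) x
      exact ⟨_, Tf_mul_Jf hb ha le_rfl⟩)
    (by
      rintro x y ⟨a, ha⟩
      obtain ⟨b, hb⟩ := exists_Tf (wtL star rk) y
      exact ⟨_, Jf_mul_Tf ha hb le_rfl⟩)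

variable (star) in
/-- projection -/
noncomputable def pr : FreeAlgebra F (Let star rk) →ₐ[F] (JI F tl hd rk star hrank).ringCon.Quotient :=
  RingCon.mkₐ F _

lemma pr_iff (t : FreeAlgebra F (Let star rk)) : pr F hrank star t = 0 ↔
    ∃ z, t ∈ Jf (wtL star rk) (Rr star rk (Reaches tl hd)) (rho F star rk) z := by
  have h1 : pr F hrank star t = 0 ↔ t ∈ JI F tl hd rk star hrank := by
    rw [TwoSidedIdeal.mem_iff, ← RingCon.eq]
    rfl
  rw [h1]
  unfold JI
  rw [TwoSidedIdeal.mem_mk']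
  rfl

include hstar0 in
lemma pr_q {v w : V} (h : Reaches tl hd v w) :
    PowerSeries.map (RingHomClass.toRingHom (pr F hrank star)) (q F star rk v w) *
    PowerSeries.map (RingHomClass.toRingHom (pr F hrank star)) (P F star rk w) =
    PowerSeries.map (RingHomClass.toRingHom (pr F hrank star)) (P F star rk v) := by
  rw [← sub_eq_zero, ← map_mul, ← map_sub]
  ext n
  rw [coeff_map, map_zero]
  exact (pr_iff F hrank _).2 ⟨_, G_mem F star rk hstar0 (reaches_dec hrank) v w h n⟩

variable (star) in
/-- backward map, before quotient -/
noncomputable def f0 : FreeAlgebra F (ESharp tl hd rk) →ₐ[F]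
    (JI F tl hd rk star hrank).ringCon.Quotient :=
  FreeAlgebra.lift F fun s => pr F hrank star (coeff s.2.1 (q F star rk (tl s.1) (hd s.1)))

lemma f0_UE (e : E) : PowerSeries.map (RingHomClass.toRingHom (f0 F hrank star)) (UE F tl hd rk e) =
    PowerSeries.map (RingHomClass.toRingHom (pr F hrank star)) (q F star rk (tl e) (hd e)) := by
  ext n
  rw [coeff_map, coeff_map]
  by_cases h0 : n = 0
  · subst h0
    rw [UE_zero, q_coeff_zero, map_one, map_one]
  by_cases hn : n ≤ len tl hd rk e
  · have := UE_mid F tl hd rk ⟨e, n, by omega, hn⟩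
    simp only at this
    rw [this]
    simp [f0]
  · rw [UE_big F tl hd rk e (by omega), q_zero F star rk _ _ (by unfold len at hn; omega),
      map_zero, map_zero]

include hstar0 in
lemma f0_path {e : E} {es : List E} (hp : IsPathC tl hd e es) :
    PowerSeries.map (RingHomClass.toRingHom (f0 F hrank star)) (UP F tl hd rk (e :: es)) *
    PowerSeries.map (RingHomClass.toRingHom (pr F hrank star)) (P F star rk (pathDst hd e es)) =
    PowerSeries.map (RingHomClass.toRingHom (pr F hrank star)) (P F star rk (tl e)) := by
  apply path_mul F (RingHomClass.toRingHom (f0 F hrank star))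
    (fun v => PowerSeries.map (RingHomClass.toRingHom (pr F hrank star)) (P F star rk v)) _ hp
  intro e
  rw [f0_UE]
  exact pr_q F hrank hstar0 (reaches_edge e)

lemma prP_const (v : V) :
    constantCoeff (PowerSeries.map (RingHomClass.toRingHom (pr F hrank star)) (P F star rk v)) = 1 := by
  rw [← coeff_zero_eq_constantCoeff_apply, coeff_map, coeff_P, ec_zero, map_one]

include hstar0 in
lemma f0_rel (x y) (h : rel F tl hd rk x y) : f0 F hrank star x = f0 F hrank star y := by
  obtain ⟨e1, es1, e2, es2, j, h1, h2, h3, h4, -, -, rfl, rfl⟩ := h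
  have k1 := f0_path F hrank hstar0 h1
  have k2 := f0_path F hrank hstar0 h2
  rw [← h3, ← h4, ← k1] at k2
  have := congrArg (coeff j) (cancel _ _ _ (prP_const F hrank _) k2)
  rw [coeff_map, coeff_map, coeff_UP, coeff_UP] at this
  exact this.symm

variable (star) in
/-- backward map -/
noncomputable def g0 : AGamma F tl hd rk →ₐ[F] (JI F tl hd rk star hrank).ringCon.Quotient :=
  RingQuot.liftAlgHom F ⟨f0 F hrank star, f0_rel F hrank hstar0⟩

lemma g0_mk (t) : g0 F hrank star hstar0 (mkA F tl hd rk t) = f0 F hrank star t := by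
  unfold g0 mkA
  exact RingQuot.liftAlgHom_mkAlgHom_apply ..

include hsel hpathOf0 hpathOfS in
lemma g0_e (x : Let star rk) : g0 F hrank star hstar0
    (mkA F tl hd rk (eP F tl hd rk (pathOf x.1.1) x.1.2)) =
    pr F hrank star (FreeAlgebra.ι F x) := by
  rw [g0_mk]
  have hx := x.2.1
  have s2 := pathOf_spec hrank hsel hpathOf0 hpathOfS (sel x.1.1)
  have k := f0_path F hrank hstar0 s2.1
  have hP : P F star rk star = 1 := by
    ext n
    rw [coeff_P, coeff_one]
    split_ifs with h
    · rw [h, ec_zero]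
    · rw [ec_big]; omega
  rw [s2.2, hsel _ hx, ← hpathOfS _ hx, hP, map_one, mul_one] at k
  have := congrArg (coeff x.1.2) k
  rw [coeff_map, coeff_map, coeff_UP, coeff_P, ec_letter] at this
  exact this

include hsel hpathOf0 hpathOfS in
lemma g0_word (w : List (Let star rk)) : g0 F hrank star hstar0
    ((w.map Subtype.val).map fun p => mkA F tl hd rk (eP F tl hd rk (pathOf p.1) p.2)).prod =
    pr F hrank star (word F w) := by
  induction w with
  | nil => simp [word_nil]
  | cons x w ih =>
    rw [word_cons, map_mul, ← ih, ← g0_e F hrank hstar0 hsel hpathOf0 hpathOfS]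
    simp

lemma word_indep {L : Type} : LinearIndependent F (fun w : List L => word F w) := by
  have h := (FreeAlgebra.basisFreeMonoid F L).linearIndependent
  have := h.comp (FreeMonoid.ofList : List L → FreeMonoid L) FreeMonoid.ofList.injective
  have e : (fun w : List L => word F w) =
      (FreeAlgebra.basisFreeMonoid F L) ∘ (FreeMonoid.ofList : List L → FreeMonoid L) := by
    funext w
    exact (basis_word w).symm
  rw [e]
  exact this

include hrank hstar0 hsel hpathOf0 hpathOfS in
theorem indep : LinearIndependent F
        (fun b : {b : List (V × ℕ) //
            (∀ p ∈ b, p.1 ≠ star ∧ 1 ≤ p.2 ∧ p.2 ≤ rk p.1) ∧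
            b.Chain' (fun p q => ¬(GLG.Reaches tl hd p.1 q.1 ∧ p.2 = rk p.1 - rk q.1))} =>
          (b.1.map fun p =>
            GLG.mkA F tl hd rk (GLG.eP F tl hd rk (pathOf p.1) p.2)).prod) := by
  apply LinearIndependent.of_comp (g0 F hrank star hstar0).toLinearMap
  have e : ∀ b : {b : List (V × ℕ) //
            (∀ p ∈ b, p.1 ≠ star ∧ 1 ≤ p.2 ∧ p.2 ≤ rk p.1) ∧
            b.Chain' (fun p q => ¬(GLG.Reaches tl hd p.1 q.1 ∧ p.2 = rk p.1 - rk q.1))},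
      ∃ w : List (Let star rk), w.map Subtype.val = b.1 := fun b =>
    ⟨b.1.attachWith _ b.2.1, List.attachWith_map_subtype_val ..⟩
  choose c hc using e
  have hcinj : Function.Injective c := by
    intro a b h
    apply Subtype.ext
    rw [← hc a, ← hc b, h]
  have h1 : LinearIndependent F (fun b => word F (c b)) := (word_indep F).comp c hcinj
  have h2 : LinearIndependent F ((pr F hrank star).toLinearMap ∘ fun b => word F (c b)) := by
    apply h1.map
    rw [Submodule.disjoint_def]
    intro t ht hk
    simp only [LinearMap.mem_ker, AlgHom.toLinearMap_apply] at hk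
    obtain ⟨z, hz⟩ := (pr_iff F hrank t).1 hk
    refine dia_ind (wtL_nonneg star rk) (H1 F star rk (reaches_dec hrank))
      (H2 F star rk hstar0 (reaches_dec hrank) (fun _ _ _ => reaches_trans)) hz ?_
    refine Submodule.span_mono ?_ ht
    rintro _ ⟨b, rfl⟩
    refine ⟨c b, ?_, rfl⟩
    have := b.2.2
    rw [← hc b] at this
    exact (List.isChain_map _).1 this
  have e2 : ((g0 F hrank star hstar0).toLinearMap ∘ fun b : {b : List (V × ℕ) //
            (∀ p ∈ b, p.1 ≠ star ∧ 1 ≤ p.2 ∧ p.2 ≤ rk p.1) ∧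
            b.Chain' (fun p q => ¬(GLG.Reaches tl hd p.1 q.1 ∧ p.2 = rk p.1 - rk q.1))} =>
          (b.1.map fun p =>
            GLG.mkA F tl hd rk (GLG.eP F tl hd rk (pathOf p.1) p.2)).prod) =
      ((pr F hrank star).toLinearMap ∘ fun b => word F (c b)) := by
    funext b
    simp only [Function.comp, AlgHom.toLinearMap_apply]
    rw [← g0_word F hrank hstar0 hsel hpathOf0 hpathOfS, hc]
  rw [e2]
  exact h2

end indep

end main

end GLGMain

/-- **Theorem 3.2(a).** Let `Γ` be a finite generalized layered graph with a
unique minimal vertex `*` with `|*| = 0`, and let `e(v,j)` be defined from the fixed paths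
`π_v` as in the paper.  Then the family of products `e(v₁,k₁)⋯e(v_r,k_r)` indexed by the
words of `𝐁(Γ)` is an `F`-vector-space basis of `A(Γ)`: it is linearly independent (hence
`ε` is injective on `𝐁(Γ)`) and it spans `A(Γ)`. -/
theorem epsilonB_is_basis (F : Type) [Field F] {V E : Type} [Fintype V] [Fintype E]
    (tl hd : E → V) (rk : V → ℕ) (hrank : GLG.IsRank tl hd rk)
    (star : V) (hstar0 : rk star = 0)
    (hmin : ∀ v : V, (∀ e : E, tl e ≠ v) ↔ v = star)
    (sel : V → E) (hsel : ∀ v : V, v ≠ star → tl (sel v) = v)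
    (pathOf : V → List E)
    (hpathOf0 : pathOf star = [])
    (hpathOfS : ∀ v : V, v ≠ star → pathOf v = sel v :: pathOf (hd (sel v))) :
    LinearIndependent F
        (fun b : {b : List (V × ℕ) //
            (∀ p ∈ b, p.1 ≠ star ∧ 1 ≤ p.2 ∧ p.2 ≤ rk p.1) ∧
            b.Chain' (fun p q => ¬(GLG.Reaches tl hd p.1 q.1 ∧ p.2 = rk p.1 - rk q.1))} =>
          (b.1.map fun p =>
            GLG.mkA F tl hd rk (GLG.eP F tl hd rk (pathOf p.1) p.2)).prod) ∧
      Submodule.span F (Set.range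
        (fun b : {b : List (V × ℕ) //
            (∀ p ∈ b, p.1 ≠ star ∧ 1 ≤ p.2 ∧ p.2 ≤ rk p.1) ∧
            b.Chain' (fun p q => ¬(GLG.Reaches tl hd p.1 q.1 ∧ p.2 = rk p.1 - rk q.1))} =>
          (b.1.map fun p =>
            GLG.mkA F tl hd rk (GLG.eP F tl hd rk (pathOf p.1) p.2)).prod)) = ⊤ := by
  exact ⟨GLGMain.indep F hrank hstar0 hsel hpathOf0 hpathOfS,
    GLGMain.spanning F hrank hstar0 hmin hsel hpathOf0 hpathOfS⟩
end

section
/- Let Γ be a finite generalized layered graph with a unique minimal vertex, and let v,w be vertices with |v| > |w|. Let Γ^e be obtained from Γ by adjoining a new edge e with t(e) = v, h(e) = w. Then the induced F-algebra homomorphism A(i^e) : A(Γ) → A(Γ^e) is surjective. -/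
open scoped BigOperators

namespace GLG

variable {V E : Type}

/-- Tail map of `Γ^e`: the new edge `none` has tail `v`. -/
def extTl (tl : E → V) (v : V) : Option E → V
  | none => v
  | some f => tl f

/-- Head map of `Γ^e`: the new edge `none` has head `w`. -/
def extHd (hd : E → V) (w : V) : Option E → V
  | none => w
  | some f => hd f

/-- The map on generators inducing `A(i^e) : A(Γ) → A(Γ^e)`: `a_j(f) ↦ a_j(f)` for
every `f ∈ E`. -/
noncomputable def extGen (F : Type) [Field F] (tl hd : E → V) (rk : V → ℕ) (v w : V) :
    ESharp tl hd rk → FreeAlgebra F (ESharp (extTl tl v) (extHd hd w) rk) :=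
  fun s => FreeAlgebra.ι F ⟨some s.1, ⟨s.2.1, s.2.2.1, s.2.2.2⟩⟩

end GLG

namespace GLG

variable {V E : Type}

theorem reach_star (tl hd : E → V) (rk : V → ℕ) (hrank : IsRank tl hd rk)
    (star : V) (hmin : ∀ u : V, (∀ e : E, tl e ≠ u) ↔ u = star) :
    ∀ (n : ℕ) (u : V), rk u = n → rk star ≤ rk u ∧ (u = star ∨ Reaches tl hd u star) := by
  intro n
  induction n using Nat.strong_induction_on with
  | _ n ih =>
    intro u hu
    by_cases h : u = star
    · exact ⟨by rw [h], Or.inl h⟩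
    · have h1 : ¬ ∀ e : E, tl e ≠ u := fun h2 => h ((hmin u).1 h2)
      push Not at h1
      obtain ⟨e, he⟩ := h1
      have hr := hrank e
      rw [he] at hr
      obtain ⟨h3, h4⟩ := ih (rk (hd e)) (by omega) (hd e) rfl
      refine ⟨by omega, Or.inr ?_⟩
      rcases h4 with h4 | ⟨f, fs, hf, ht, hdst⟩
      · exact ⟨e, [], List.IsChain.singleton _, he, by simpa [pathDst] using h4⟩
      · refine ⟨e, f :: fs, ?_, he, ?_⟩
        · unfold IsPathC at hf ⊢
          exact List.IsChain.cons_cons ht.symm hf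
        · simpa [pathDst] using hdst

theorem lift_path (tl hd : E → V) (v w : V) (e : E) (es : List E) (h : IsPathC tl hd e es) :
    IsPathC (extTl tl v) (extHd hd w) (some e) (es.map some) := by
  unfold IsPathC at h ⊢
  have := (List.isChain_map (R := fun a b => extHd hd w a = extTl tl v b) some
    (l := e :: es)).2 h
  rw [List.map_cons] at this
  exact this

theorem lift_dst (hd : E → V) (w : V) (e : E) (es : List E) :
    pathDst (extHd hd w) (some e) (es.map some) = pathDst hd e es := by
  unfold pathDst
  have : (some e :: es.map some).getLast (List.cons_ne_nil _ _)
      = some ((e :: es).getLast (List.cons_ne_nil _ _)) := by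
    have h := List.getLast_map (f := (some : E → Option E)) (l := e :: es) (by simp)
    simpa only [List.map_cons] using h
  rw [this]
  rfl

theorem Pe_coeff_zero (F : Type) [Field F] (tl hd : E → V) (rk : V → ℕ) (e : E) :
    (Pe F tl hd rk e).coeff 0 = 1 := by
  unfold Pe
  rw [Polynomial.coeff_add, Polynomial.finsetSum_coeff, Finset.sum_eq_zero]
  · simp
  · rintro ⟨j, hj⟩ -
    rw [Polynomial.coeff_C_mul_X_pow, if_neg]
    have := (Finset.mem_Icc.mp hj).1
    simp only
    omega

theorem Pe_coeff_s8 (F : Type) [Field F] (tl hd : E → V) (rk : V → ℕ) (e : E) (n : ℕ)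
    (h1 : 1 ≤ n) (h2 : n ≤ len tl hd rk e) :
    (Pe F tl hd rk e).coeff n = (-1) ^ n * FreeAlgebra.ι F ⟨e, ⟨n, h1, h2⟩⟩ := by
  unfold Pe
  rw [Polynomial.coeff_add, Polynomial.finsetSum_coeff,
    Finset.sum_eq_single ⟨n, Finset.mem_Icc.2 ⟨h1, h2⟩⟩]
  · rw [Polynomial.coeff_C_mul_X_pow, if_pos rfl, Polynomial.coeff_one, if_neg (by omega), zero_add]
  · rintro ⟨j, hj⟩ - hne
    rw [Polynomial.coeff_C_mul_X_pow, if_neg]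
    intro h
    exact hne (Subtype.ext h.symm)
  · intro h
    exact absurd (Finset.mem_attach _ _) h

theorem Pe_coeff_mem (F : Type) [Field F] (tl hd : E → V) (rk : V → ℕ) (e : E)
    (T : Subalgebra F (FreeAlgebra F (ESharp tl hd rk)))
    (hT : ∀ i, FreeAlgebra.ι F (⟨e, i⟩ : ESharp tl hd rk) ∈ T) (n : ℕ) :
    (Pe F tl hd rk e).coeff n ∈ T := by
  unfold Pe
  rw [Polynomial.coeff_add, Polynomial.finsetSum_coeff]
  refine T.add_mem ?_ (T.sum_mem ?_)
  · rw [Polynomial.coeff_one]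
    split_ifs
    · exact T.one_mem
    · exact T.zero_mem
  · rintro j -
    rw [Polynomial.coeff_C_mul_X_pow]
    split_ifs
    · exact T.mul_mem (T.pow_mem (T.neg_mem T.one_mem) _) (hT _)
    · exact T.zero_mem

theorem prod_coeff_mem (F : Type) [Field F] (tl hd : E → V) (rk : V → ℕ) (es : List E)
    (T : Subalgebra F (FreeAlgebra F (ESharp tl hd rk)))
    (hT : ∀ e ∈ es, ∀ i, FreeAlgebra.ι F (⟨e, i⟩ : ESharp tl hd rk) ∈ T) (n : ℕ) :
    ((es.map (Pe F tl hd rk)).prod).coeff n ∈ T := by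
  induction es generalizing n with
  | nil =>
    simp only [List.map_nil, List.prod_nil, Polynomial.coeff_one]
    split_ifs
    · exact T.one_mem
    · exact T.zero_mem
  | cons e es ih =>
    rw [List.map_cons, List.prod_cons, Polynomial.coeff_mul]
    refine T.sum_mem fun x _ => T.mul_mem ?_ ?_
    · exact Pe_coeff_mem F tl hd rk e T (hT e (by simp)) _
    · exact ih (fun f hf => hT f (by simp [hf])) _

theorem prod_coeff_zero (F : Type) [Field F] (tl hd : E → V) (rk : V → ℕ) (es : List E) :
    ((es.map (Pe F tl hd rk)).prod).coeff 0 = 1 := by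
  induction es with
  | nil => simp
  | cons e es ih =>
    rw [List.map_cons, List.prod_cons, Polynomial.mul_coeff_zero, ih, Pe_coeff_zero, one_mul]

theorem eP_rel (F : Type) [Field F] (tl hd : E → V) (rk : V → ℕ) (e1 e2 : E) (es1 es2 : List E)
    (h1 : IsPathC tl hd e1 es1) (h2 : IsPathC tl hd e2 es2) (ht : tl e1 = tl e2)
    (hh : pathDst hd e1 es1 = pathDst hd e2 es2) (j : ℕ) (hj : 1 ≤ j)
    (hj2 : j ≤ rk (tl e1) - rk (pathDst hd e1 es1)) :
    mkA F tl hd rk ((((e1 :: es1).map (Pe F tl hd rk)).prod).coeff j) =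
    mkA F tl hd rk ((((e2 :: es2).map (Pe F tl hd rk)).prod).coeff j) := by
  have h : mkA F tl hd rk (eP F tl hd rk (e1 :: es1) j) =
      mkA F tl hd rk (eP F tl hd rk (e2 :: es2) j) :=
    RingQuot.mkAlgHom_rel F ⟨e1, es1, e2, es2, j, h1, h2, ht, hh, hj, hj2, rfl, rfl⟩
  unfold eP at h
  rw [map_mul, map_mul] at h
  have hu : IsUnit (mkA F tl hd rk ((-1) ^ j)) :=
    ((isUnit_one.neg).pow j).map _
  exact hu.mul_left_cancel h

end GLG

/-- **Proposition 3.3.** Let `Γ` be a finite generalized layered graph with a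
unique minimal vertex, and let `v, w` be vertices with `|v| > |w|`.  Let `Γ^e` be obtained
from `Γ` by adjoining a new edge `e` with `t(e) = v`, `h(e) = w`.  Then the induced
`F`-algebra homomorphism `A(i^e) : A(Γ) → A(Γ^e)` (the one commuting with the inclusion of
generators) is surjective. -/
theorem Aie_surjective (F : Type) [Field F] {V E : Type} [Fintype V] [Fintype E]
    (tl hd : E → V) (rk : V → ℕ) (hrank : GLG.IsRank tl hd rk)
    (star : V) (hmin : ∀ u : V, (∀ e : E, tl e ≠ u) ↔ u = star)
    (v w : V) (hvw : rk w < rk v)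
    (φ : GLG.AGamma F tl hd rk →ₐ[F] GLG.AGamma F (GLG.extTl tl v) (GLG.extHd hd w) rk)
    (hφ : ∀ x : FreeAlgebra F (GLG.ESharp tl hd rk),
      φ (GLG.mkA F tl hd rk x) =
        GLG.mkA F (GLG.extTl tl v) (GLG.extHd hd w) rk
          (FreeAlgebra.lift F (GLG.extGen F tl hd rk v w) x)) :
    Function.Surjective φ := by
  classical
  set T : Subalgebra F (FreeAlgebra F (GLG.ESharp (GLG.extTl tl v) (GLG.extHd hd w) rk)) :=
    φ.range.comap (GLG.mkA F (GLG.extTl tl v) (GLG.extHd hd w) rk) with hTdef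
  have hTmem : ∀ x, x ∈ T ↔ ∃ y, φ y = GLG.mkA F (GLG.extTl tl v) (GLG.extHd hd w) rk x := fun x => Iff.rfl
  have hcong : ∀ x y, GLG.mkA F (GLG.extTl tl v) (GLG.extHd hd w) rk x = GLG.mkA F (GLG.extTl tl v) (GLG.extHd hd w) rk y → x ∈ T → y ∈ T := by
    intro x y h hx
    rw [hTmem] at hx ⊢
    rw [← h]; exact hx
  have hsome : ∀ (f : E) i, FreeAlgebra.ι F (⟨some f, i⟩ : GLG.ESharp (GLG.extTl tl v) (GLG.extHd hd w) rk) ∈ T := by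
    rintro f ⟨i, hi⟩
    rw [hTmem]
    refine ⟨GLG.mkA F tl hd rk (FreeAlgebra.ι F ⟨f, ⟨i, hi⟩⟩), ?_⟩
    rw [hφ, FreeAlgebra.lift_ι_apply]
    rfl
  have hlist : ∀ (es : List E) n,
      (((es.map some).map (GLG.Pe F (GLG.extTl tl v) (GLG.extHd hd w) rk)).prod).coeff n ∈ T := by
    intro es n
    refine GLG.prod_coeff_mem F (GLG.extTl tl v) (GLG.extHd hd w) rk _ T ?_ n
    intro e he
    obtain ⟨f, -, rfl⟩ := List.mem_map.1 he
    exact hsome f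
  obtain ⟨hws, hwp⟩ := GLG.reach_star tl hd rk hrank star hmin _ w rfl
  obtain ⟨hvs, hvp⟩ := GLG.reach_star tl hd rk hrank star hmin _ v rfl
  obtain ⟨p, ps, hp, hpt, hpd⟩ : GLG.Reaches tl hd v star := by
    rcases hvp with h | h
    · rw [h] at hvw; omega
    · exact h
  have hq : ∃ qs : List E, GLG.IsPathC (GLG.extTl tl v) (GLG.extHd hd w) none (qs.map some) ∧
      GLG.pathDst (GLG.extHd hd w) none (qs.map some) = star := by
    rcases hwp with h | ⟨q, qs, hq, hqt, hqd⟩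
    · exact ⟨[], List.IsChain.singleton _, h⟩
    · refine ⟨q :: qs, ?_, ?_⟩
      · have := GLG.lift_path tl hd v w q qs hq
        unfold GLG.IsPathC at this ⊢
        exact List.IsChain.cons_cons hqt.symm this
      · have := GLG.lift_dst hd w q qs
        rw [hqd] at this
        simpa [GLG.pathDst] using this
  obtain ⟨qs, hqs, hqd⟩ := hq
  have hnone : ∀ n, n ≤ GLG.len (GLG.extTl tl v) (GLG.extHd hd w) rk none → (GLG.Pe F (GLG.extTl tl v) (GLG.extHd hd w) rk none).coeff n ∈ T := by
    intro n
    induction n using Nat.strong_induction_on with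
    | _ n ih =>
      intro hn
      rcases Nat.eq_zero_or_pos n with rfl | hpos
      · rw [GLG.Pe_coeff_zero]; exact T.one_mem
      have hn' : n ≤ rk v - rk w := hn
      have key := GLG.eP_rel F (GLG.extTl tl v) (GLG.extHd hd w) rk (some p) none (ps.map some) (qs.map some)
        (GLG.lift_path tl hd v w p ps hp) hqs hpt
        (by rw [hqd, ← hpd]; exact GLG.lift_dst hd w p ps) n hpos
        (by
          have h1 : GLG.pathDst (GLG.extHd hd w) (some p) (ps.map some) = star :=
            (GLG.lift_dst hd w p ps).trans hpd
          have h2 : (GLG.extTl tl v) (some p) = v := hpt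
          rw [h1, h2]; omega)
      have hmem := hcong _ _ key (hlist (p :: ps) n)
      rw [List.map_cons, List.prod_cons, Polynomial.coeff_mul,
        Finset.Nat.sum_antidiagonal_eq_sum_range_succ_mk, Finset.sum_range_succ] at hmem
      simp only [Nat.sub_self, GLG.prod_coeff_zero, mul_one] at hmem
      refine (T.toSubmodule.add_mem_iff_right ?_).1 hmem
      refine T.sum_mem fun k hk => ?_
      have hk' := Finset.mem_range.1 hk
      exact T.mul_mem (ih k hk' (by omega)) (hlist qs _)
  have hgen : ∀ s, FreeAlgebra.ι F (s : GLG.ESharp (GLG.extTl tl v) (GLG.extHd hd w) rk) ∈ T := by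
    rintro ⟨f | f, i⟩
    · obtain ⟨i, hi1, hi2⟩ := i
      have h := hnone i hi2
      rw [GLG.Pe_coeff_s8 F (GLG.extTl tl v) (GLG.extHd hd w) rk none i hi1 hi2] at h
      have h2 := T.mul_mem (T.pow_mem (T.neg_mem T.one_mem) i) h
      rwa [← mul_assoc, ← pow_add, Even.neg_one_pow ⟨i, rfl⟩, one_mul] at h2
    · exact hsome f i
  have htop : T = ⊤ := by
    rw [eq_top_iff, ← FreeAlgebra.adjoin_range_ι]
    refine Algebra.adjoin_le ?_
    rintro _ ⟨s, rfl⟩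
    exact hgen s
  intro y
  obtain ⟨x, rfl⟩ := RingQuot.mkAlgHom_surjective F (GLG.rel F (GLG.extTl tl v) (GLG.extHd hd w) rk) y
  have : x ∈ T := by rw [htop]; trivial
  exact (hTmem x).1 this
end
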